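/- Stability of the L²-Poincaré inequality (Corollary 3.3): Let Ω ⊂ ℝⁿ (n ≥ 2) be an open bounded convex set with smooth boundary, of diameter diam(Ω), and let u₁ be a first Dirichlet eigenfunction of the Laplacian on Ω (positive in Ω, with log u₁ concave). Then for every real-valued smooth function u with compact support in Ω: ∫_Ω |∇u|² dx − λ₁(2,Ω) ∫_Ω |u|² dx ≥ (π / diam(Ω))² · inf_{c∈ℝ} ∫_Ω |u − c·u₁|² dx. -/

import Mathlib

open MeasureTheory Real Filter
open scoped RealInnerProductSpace

/-- The first Dirichlet eigenvalue of the `p`-Laplacian on `Ω`, defined as the infimum of the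
Rayleigh quotients over smooth nontrivial functions compactly supported in `Ω`. -/
noncomputable def lambda1 (n : ℕ) (p : ℝ) (Ω : Set (EuclideanSpace ℝ (Fin n))) : ℝ :=
  sInf { r : ℝ | ∃ u : EuclideanSpace ℝ (Fin n) → ℝ,
    ContDiff ℝ (⊤ : ℕ∞) u ∧ HasCompactSupport u ∧ tsupport u ⊆ Ω ∧ u ≠ 0 ∧
    r = (∫ x in Ω, ‖gradient u x‖ ^ p) / (∫ x in Ω, |u x| ^ p) }

/-- Pointwise Picone-type inequality behind the one-dimensional weighted Poincaré inequality. -/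
lemma picone_pointwise {k r r1 r2 g g1 G τ : ℝ} (hr : 0 < r) (hlc : r * r2 ≤ r1 ^ 2) :
    k ^ 2 * (2 * G * (g * r) * (τ + r1 / (2 * r)) / r
        + G ^ 2 * (-k ^ 2 - τ ^ 2 + (r2 * r - r1 ^ 2) / (2 * r ^ 2)) / r
        - G ^ 2 * (τ + r1 / (2 * r)) * r1 / r ^ 2 - 2 * (g * r * g + G * g1))
      ≤ r * g1 ^ 2 - k ^ 2 * (r * g ^ 2) := by
  have key : r * g1 ^ 2 - k ^ 2 * (r * g ^ 2)
      - k ^ 2 * (2 * G * (g * r) * (τ + r1 / (2 * r)) / r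
        + G ^ 2 * (-k ^ 2 - τ ^ 2 + (r2 * r - r1 ^ 2) / (2 * r ^ 2)) / r
        - G ^ 2 * (τ + r1 / (2 * r)) * r1 / r ^ 2 - 2 * (g * r * g + G * g1))
      = (r * g1 + k ^ 2 * G) ^ 2 / r + k ^ 2 * (r * g - G * (τ + r1 / (2 * r))) ^ 2 / r
        + k ^ 2 * G ^ 2 * (r1 ^ 2 - r * r2) / (2 * r ^ 3)
        + k ^ 2 * G ^ 2 * r1 ^ 2 / (4 * r ^ 3) := by
    field_simp
    ring
  have h1 : 0 ≤ (r * g1 + k ^ 2 * G) ^ 2 / r := by positivity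
  have h2 : 0 ≤ k ^ 2 * (r * g - G * (τ + r1 / (2 * r))) ^ 2 / r := by positivity
  have h3 : 0 ≤ k ^ 2 * G ^ 2 * (r1 ^ 2 - r * r2) / (2 * r ^ 3) := by
    apply div_nonneg
    · exact mul_nonneg (by positivity) (by linarith)
    · positivity
  have h4 : 0 ≤ k ^ 2 * G ^ 2 * r1 ^ 2 / (4 * r ^ 3) := by positivity
  linarith

/-- Weighted Poincaré inequality for mean-zero functions on a compact interval, with a smooth
positive log-concave weight. -/
lemma poincare_interval_of_mean_zero {a b k : ℝ} (hab : a < b) (hk : 0 < k)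
    (hL : k * (b - a) < π) {r r1 r2 g g1 : ℝ → ℝ}
    (hr : ∀ t, HasDerivAt r (r1 t) t) (hr1 : ∀ t, HasDerivAt r1 (r2 t) t)
    (hg : ∀ t, HasDerivAt g (g1 t) t) (hg1 : Continuous g1)
    (hpos : ∀ t ∈ Set.Icc a b, 0 < r t)
    (hlc : ∀ t ∈ Set.Icc a b, r t * r2 t ≤ r1 t ^ 2)
    (hmean : ∫ t in a..b, g t * r t = 0) :
    k ^ 2 * ∫ t in a..b, r t * g t ^ 2 ≤ ∫ t in a..b, r t * g1 t ^ 2 := by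
  have hrc : Continuous r := continuous_iff_continuousAt.2 fun t => (hr t).continuousAt
  have hgc : Continuous g := continuous_iff_continuousAt.2 fun t => (hg t).continuousAt
  set m := (a + b) / 2 with hm
  set G : ℝ → ℝ := fun t => ∫ s in a..t, g s * r s with hG
  have hG' : ∀ t, HasDerivAt G (g t * r t) t := fun t =>
    ((hgc.mul hrc).integral_hasStrictDerivAt a t).hasDerivAt
  set Φ : ℝ → ℝ := fun t => ∫ s in a..t, (r s * g1 s ^ 2 - k ^ 2 * (r s * g s ^ 2)) with hΦ
  have hcont : Continuous fun s => r s * g1 s ^ 2 - k ^ 2 * (r s * g s ^ 2) := by fun_prop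
  have hΦ' : ∀ t, HasDerivAt Φ (r t * g1 t ^ 2 - k ^ 2 * (r t * g t ^ 2)) t := fun t =>
    (hcont.integral_hasStrictDerivAt a t).hasDerivAt
  have hcos : ∀ t ∈ Set.Icc a b, 0 < cos (k * (t - m)) := by
    intro t ht
    apply cos_pos_of_mem_Ioo
    constructor
    · nlinarith [ht.1, ht.2]
    · nlinarith [ht.1, ht.2]
  set T : ℝ → ℝ := fun t => -k * tan (k * (t - m)) with hT
  have hT' : ∀ t ∈ Set.Icc a b, HasDerivAt T (-k ^ 2 - T t ^ 2) t := by
    intro t ht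
    have hc := (hcos t ht).ne'
    have h1 : HasDerivAt (fun t : ℝ => k * (t - m)) (k * 1) t :=
      ((hasDerivAt_id t).sub_const m).const_mul k
    have h2 := ((hasDerivAt_tan hc).comp t h1).const_mul (-k)
    refine h2.congr_deriv ?_
    simp only [hT, tan_eq_sin_div_cos]
    field_simp
    linear_combination sin_sq_add_cos_sq (k * (t - m))
  set B : ℝ → ℝ := fun t => G t ^ 2 * (T t + r1 t / (2 * r t)) / r t - 2 * (G t * g t) with hB
  have hB' : ∀ t ∈ Set.Icc a b, HasDerivAt B
      (2 * G t * (g t * r t) * (T t + r1 t / (2 * r t)) / r t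
        + G t ^ 2 * (-k ^ 2 - T t ^ 2 + (r2 t * r t - r1 t ^ 2) / (2 * r t ^ 2)) / r t
        - G t ^ 2 * (T t + r1 t / (2 * r t)) * r1 t / r t ^ 2
        - 2 * (g t * r t * g t + G t * g1 t)) t := by
    intro t ht
    have hp := (hpos t ht).ne'
    have e1 := (hG' t).pow 2
    have e2 := (hr1 t).div ((hr t).const_mul 2) (by positivity)
    have e3 := (((e1.mul ((hT' t ht).add e2)).div (hr t) hp).sub
      (((hG' t).mul (hg t)).const_mul 2))
    refine e3.congr_deriv ?_
    simp only [Pi.mul_apply, Pi.add_apply, Pi.pow_apply, Pi.div_apply]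
    field_simp
    ring
  have hmono : MonotoneOn (fun t => Φ t - k ^ 2 * B t) (Set.Icc a b) := by
    have hd : ∀ t ∈ Set.Icc a b, HasDerivAt (fun t => Φ t - k ^ 2 * B t) _ t :=
      fun t ht => (hΦ' t).sub ((hB' t ht).const_mul (k ^ 2))
    refine monotoneOn_of_deriv_nonneg (convex_Icc a b)
      (fun t ht => (hd t ht).continuousAt.continuousWithinAt)
      (fun t ht => (hd t (interior_subset ht)).differentiableAt.differentiableWithinAt) ?_
    intro t ht
    have ht' := interior_subset ht
    rw [(hd t ht').deriv]
    have := picone_pointwise (k := k) (g := g t) (g1 := g1 t) (G := G t) (τ := T t)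
      (hpos t ht') (hlc t ht')
    linarith
  have hGa : G a = 0 := by simp [hG]
  have hGb : G b = 0 := hmean
  have hle := hmono (Set.left_mem_Icc.2 hab.le) (Set.right_mem_Icc.2 hab.le) hab.le
  have hΦa : Φ a = 0 := by simp [hΦ]
  simp only [hB, hGa, hGb, hΦa] at hle
  have hsplit : Φ b = (∫ t in a..b, r t * g1 t ^ 2) - k ^ 2 * ∫ t in a..b, r t * g t ^ 2 := by
    simp only [hΦ]
    rw [intervalIntegral.integral_sub, intervalIntegral.integral_const_mul]
    · exact (by fun_prop : Continuous fun t => r t * g1 t ^ 2).intervalIntegrable _ _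
    · exact (by fun_prop : Continuous fun t => k ^ 2 * (r t * g t ^ 2)).intervalIntegrable _ _
  rw [hsplit] at hle
  norm_num at hle
  linarith

/-- Weighted Poincaré inequality on a compact interval, in variance form. -/
lemma poincare_interval {a b k : ℝ} (hab : a < b) (hk : 0 < k)
    (hL : k * (b - a) < π) {r r1 r2 g g1 : ℝ → ℝ}
    (hr : ∀ t, HasDerivAt r (r1 t) t) (hr1 : ∀ t, HasDerivAt r1 (r2 t) t)
    (hg : ∀ t, HasDerivAt g (g1 t) t) (hg1 : Continuous g1)
    (hpos : ∀ t ∈ Set.Icc a b, 0 < r t)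
    (hlc : ∀ t ∈ Set.Icc a b, r t * r2 t ≤ r1 t ^ 2) :
    k ^ 2 * ((∫ t in a..b, r t) * (∫ t in a..b, r t * g t ^ 2) - (∫ t in a..b, r t * g t) ^ 2)
      ≤ (∫ t in a..b, r t) * ∫ t in a..b, r t * g1 t ^ 2 := by
  have hrc : Continuous r := continuous_iff_continuousAt.2 fun t => (hr t).continuousAt
  have hgc : Continuous g := continuous_iff_continuousAt.2 fun t => (hg t).continuousAt
  have hR : 0 < ∫ t in a..b, r t :=
    intervalIntegral.intervalIntegral_pos_of_pos_on (hrc.intervalIntegrable _ _)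
      (fun t ht => hpos t (Set.Ioo_subset_Icc_self ht)) hab
  set R := ∫ t in a..b, r t with hRdef
  set M := ∫ t in a..b, r t * g t with hM
  set S := ∫ t in a..b, r t * g t ^ 2 with hS
  set c := M / R with hc
  have hcR : c * R = M := by rw [hc]; field_simp
  have i1 : IntervalIntegrable (fun t => r t * g t) volume a b :=
    (hrc.mul hgc).intervalIntegrable _ _
  have i2 : IntervalIntegrable (fun t => r t * g t ^ 2) volume a b :=
    (hrc.mul (hgc.pow 2)).intervalIntegrable _ _
  have i0 : IntervalIntegrable r volume a b := hrc.intervalIntegrable _ _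
  have hmean : ∫ t in a..b, (g t - c) * r t = 0 := by
    have : (fun t => (g t - c) * r t) = fun t => r t * g t - c * r t := by
      funext t; ring
    rw [this, intervalIntegral.integral_sub i1 (i0.const_mul c),
      intervalIntegral.integral_const_mul, ← hRdef, ← hM, hcR, sub_self]
  have key := poincare_interval_of_mean_zero hab hk hL hr hr1
    (fun t => (hg t).sub_const c) hg1 hpos hlc hmean
  have hexp : ∫ t in a..b, r t * (g t - c) ^ 2 = S - 2 * c * M + c ^ 2 * R := by
    have : (fun t => r t * (g t - c) ^ 2)
        = fun t => r t * g t ^ 2 - 2 * c * (r t * g t) + c ^ 2 * r t := by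
      funext t; ring
    rw [this, intervalIntegral.integral_add (i2.sub (i1.const_mul _)) (i0.const_mul _),
      intervalIntegral.integral_sub i2 (i1.const_mul _), intervalIntegral.integral_const_mul,
      intervalIntegral.integral_const_mul]
  rw [hexp] at key
  have := mul_le_mul_of_nonneg_left key hR.le
  calc k ^ 2 * (R * S - M ^ 2) = R * (k ^ 2 * (S - 2 * c * M + c ^ 2 * R)) := by
        rw [← hcR]; ring
    _ ≤ _ := this

/-- Multiplicative (real-exponent) form of log-concavity; meant for nonnegative functions. -/
def LogConcave {V : Type*} [AddCommGroup V] [Module ℝ V] (F : V → ℝ) : Prop :=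
  ∀ x y : V, ∀ a b : ℝ, 0 < a → 0 < b → a + b = 1 → F x ^ a * F y ^ b ≤ F (a • x + b • y)

lemma LogConcave.mul {V : Type*} [AddCommGroup V] [Module ℝ V] {F H : V → ℝ}
    (hF : LogConcave F) (hH : LogConcave H) (hF0 : ∀ x, 0 ≤ F x) (hH0 : ∀ x, 0 ≤ H x) :
    LogConcave fun x => F x * H x := by
  intro x y a b ha hb hab
  rw [mul_rpow (hF0 x) (hH0 x), mul_rpow (hF0 y) (hH0 y)]
  calc _ = (F x ^ a * F y ^ b) * (H x ^ a * H y ^ b) := by ring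
    _ ≤ _ := mul_le_mul (hF x y a b ha hb hab) (hH x y a b ha hb hab)
      (mul_nonneg (rpow_nonneg (hH0 x) _) (rpow_nonneg (hH0 y) _)) (hF0 _)

lemma LogConcave.comp_linear {V W : Type*} [AddCommGroup V] [Module ℝ V] [AddCommGroup W]
    [Module ℝ W] {F : W → ℝ} (hF : LogConcave F) (T : V →ₗ[ℝ] W) :
    LogConcave fun x => F (T x) := by
  intro x y a b ha hb hab
  simpa using hF (T x) (T y) a b ha hb hab

lemma LogConcave.convex_pos {V : Type*} [AddCommGroup V] [Module ℝ V] {F : V → ℝ}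
    (hF : LogConcave F) : Convex ℝ {x | 0 < F x} := by
  rw [convex_iff_forall_pos]
  intro x hx y hy a b ha hb hab
  exact lt_of_lt_of_le (mul_pos (rpow_pos_of_pos hx _) (rpow_pos_of_pos hy _))
    (hF x y a b ha hb hab)

lemma LogConcave.mul_le_sq {r : ℝ → ℝ} (hr : LogConcave r) (h0 : ∀ t, 0 ≤ r t) (s h : ℝ) :
    r (s - h) * r (s + h) ≤ r s ^ 2 := by
  have := hr (s - h) (s + h) (1 / 2) (1 / 2) (by norm_num) (by norm_num) (by norm_num)
  have e : (1 / 2 : ℝ) • (s - h) + (1 / 2 : ℝ) • (s + h) = s := by simp; ring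
  rw [e, ← mul_rpow (h0 _) (h0 _), ← sqrt_eq_rpow] at this
  rw [← sqrt_le_left (h0 s)]
  exact this

/-- A twice differentiable log-concave function `r`, with derivatives `r1` and `r2`, satisfies
`r * r2 ≤ r1 ^ 2`. -/
lemma LogConcave.mul_deriv2_le {r r1 r2 : ℝ → ℝ} (hlc : LogConcave r) (h0 : ∀ t, 0 ≤ r t)
    (hr : ∀ t, HasDerivAt r (r1 t) t) (hr1 : ∀ t, HasDerivAt r1 (r2 t) t) (s : ℝ) :
    r s * r2 s ≤ r1 s ^ 2 := by
  by_contra! hcon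
  set φ : ℝ → ℝ := fun h => r s ^ 2 - r (s - h) * r (s + h) with hφ
  set φ1 : ℝ → ℝ := fun h => r1 (s - h) * r (s + h) - r (s - h) * r1 (s + h) with hφ1
  have sh1 : ∀ {f f1 : ℝ → ℝ}, (∀ t, HasDerivAt f (f1 t) t) → ∀ h,
      HasDerivAt (fun h => f (s - h)) (-f1 (s - h)) h := by
    intro f f1 hf h
    exact (hf (s - h)).comp_const_sub s h
  have sh2 : ∀ {f f1 : ℝ → ℝ}, (∀ t, HasDerivAt f (f1 t) t) → ∀ h,
      HasDerivAt (fun h => f (s + h)) (f1 (s + h)) h := by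
    intro f f1 hf h
    exact (hf (s + h)).comp_const_add s h
  have hd : ∀ h, HasDerivAt φ (φ1 h) h := by
    intro h
    refine (((sh1 hr h).mul (sh2 hr h)).const_sub (r s ^ 2)).congr_deriv ?_
    simp only [hφ1]; ring
  have hd1 : HasDerivAt φ1 (2 * (r1 s ^ 2 - r s * r2 s)) 0 := by
    refine (((sh1 hr1 0).mul (sh2 hr 0)).sub ((sh1 hr 0).mul (sh2 hr1 0))).congr_deriv ?_
    simp only [sub_zero, add_zero]; ring
  have hderiv : deriv φ = φ1 := funext fun h => (hd h).deriv
  have hmax : IsLocalMax φ 0 := by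
    apply isLocalMax_of_deriv_deriv_neg
    · rw [hderiv, hd1.deriv]; linarith
    · rw [hderiv]; simp [hφ1]; ring
    · exact (hd 0).continuousAt
  have hφ0 : φ 0 = 0 := by simp [hφ]; ring
  have hzero : φ =ᶠ[nhds 0] fun _ => 0 := by
    filter_upwards [hmax] with h hh
    rw [hφ0] at hh
    exact le_antisymm hh (sub_nonneg.2 (hlc.mul_le_sq h0 s h))
  have h2 : deriv (deriv φ) 0 = 0 := by
    rw [hzero.deriv.deriv_eq]; simp
  rw [hderiv, hd1.deriv] at h2
  linarith

/-- Weighted Poincaré inequality on the line, for a `C²` log-concave weight supported in an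
interval `[A, B]`. -/
lemma poincare_line {A B k : ℝ} (hk : 0 < k) (hL : k * (B - A) < π) {r g : ℝ → ℝ}
    (hrC : ContDiff ℝ 2 r) (h0 : ∀ t, 0 ≤ r t) (hlc : LogConcave r)
    (hsupp : ∀ t, t ∉ Set.Icc A B → r t = 0) (hg : ContDiff ℝ 1 g) :
    k ^ 2 * ((∫ t, r t) * (∫ t, r t * g t ^ 2) - (∫ t, r t * g t) ^ 2)
      ≤ (∫ t, r t) * ∫ t, r t * deriv g t ^ 2 := by
  by_cases hne : ∃ t, r t ≠ 0
  swap
  · push Not at hne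
    simp [hne]
  have hr : ∀ t, HasDerivAt r (deriv r t) t := fun t =>
    (hrC.differentiable (by norm_num) t).hasDerivAt
  have hr1 : ∀ t, HasDerivAt (deriv r) (deriv (deriv r) t) t := fun t =>
    (((contDiff_succ_iff_deriv (n := 1)).1 hrC).2.2.differentiable (by norm_num) t).hasDerivAt
  have hg' : ∀ t, HasDerivAt g (deriv g t) t := fun t =>
    (hg.differentiable (by norm_num) t).hasDerivAt
  have hg1 : Continuous (deriv g) := hg.continuous_deriv (by norm_num)
  have hrc := hrC.continuous
  have hgc := hg.continuous
  set S := {t | 0 < r t} with hS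
  have hSsub : S ⊆ Set.Icc A B := by
    intro t ht
    by_contra hn
    exact (ne_of_gt ht) (hsupp t hn)
  have hSne : S.Nonempty := by
    obtain ⟨t, ht⟩ := hne
    exact ⟨t, lt_of_le_of_ne (h0 t) (Ne.symm ht)⟩
  have hSo : IsOpen S := isOpen_lt continuous_const hrc
  have hSc : Convex ℝ S := hlc.convex_pos
  have hbb : BddBelow S := bddBelow_Icc.mono hSsub
  have hba : BddAbove S := bddAbove_Icc.mono hSsub
  set α := sInf S with hα
  set β := sSup S with hβ
  have hAα : A ≤ α := le_csInf hSne fun t ht => (hSsub ht).1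
  have hβB : β ≤ B := csSup_le hSne fun t ht => (hSsub ht).2
  have hIoo : ∀ t ∈ Set.Ioo α β, t ∈ S := by
    intro t ht
    obtain ⟨x, hx, hxt⟩ := exists_lt_of_csInf_lt hSne ht.1
    obtain ⟨y, hy, hyt⟩ := exists_lt_of_lt_csSup hSne ht.2
    exact hSc.ordConnected.out hx hy ⟨hxt.le, hyt.le⟩
  have hSIcc : S ⊆ Set.Icc α β := fun t ht => ⟨csInf_le hbb ht, le_csSup hba ht⟩
  have hαβ : α < β := by
    obtain ⟨t, ht⟩ := hSne
    obtain ⟨ε, hε, hball⟩ := Metric.isOpen_iff.1 hSo t ht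
    have h1 : t + ε / 2 ∈ S := hball (by
      rw [Metric.mem_ball, Real.dist_eq, add_sub_cancel_left, abs_of_pos (half_pos hε)]
      exact half_lt_self hε)
    have := hSIcc h1
    have := hSIcc ht
    linarith [this.1, this.2, (hSIcc h1).2]
  have hconv : ∀ H : ℝ → ℝ, ∫ t, r t * H t = ∫ t in α..β, r t * H t := by
    intro H
    rw [intervalIntegral.integral_of_le hαβ.le, ← integral_Icc_eq_integral_Ioc,
      setIntegral_eq_integral_of_forall_compl_eq_zero]
    intro t ht
    have : r t = 0 := by
      by_contra hn
      exact ht (hSIcc (lt_of_le_of_ne (h0 t) (Ne.symm hn)))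
    simp [this]
  have hlim : ∀ H : ℝ → ℝ, Continuous H →
      Tendsto (fun τ : ℝ => ∫ t in (α + τ)..(β - τ), H t) (nhdsWithin 0 (Set.Ioi 0))
        (nhds (∫ t in α..β, H t)) := by
    intro H hH
    have hint : ∀ a b, IntervalIntegrable H volume a b := fun a b => hH.intervalIntegrable a b
    have hP : Continuous fun b => ∫ t in (0 : ℝ)..b, H t :=
      intervalIntegral.continuous_primitive hint 0
    have heq : ∀ a b : ℝ, ∫ t in a..b, H t = (∫ t in (0 : ℝ)..b, H t) - ∫ t in (0 : ℝ)..a, H t :=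
      fun a b => (intervalIntegral.integral_interval_sub_left (hint _ _) (hint _ _)).symm
    have hcont : Continuous fun τ : ℝ => ∫ t in (α + τ)..(β - τ), H t := by
      rw [show (fun τ : ℝ => ∫ t in (α + τ)..(β - τ), H t) = _ from
        funext fun τ => heq (α + τ) (β - τ)]
      exact (hP.comp (by fun_prop)).sub (hP.comp (by fun_prop))
    have := hcont.tendsto 0
    simp only [add_zero, sub_zero] at this
    exact this.mono_left nhdsWithin_le_nhds
  have e1 : ∫ t, r t = ∫ t in α..β, r t := by
    have := hconv fun _ => 1
    simp only [mul_one] at this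
    exact this
  rw [e1, hconv, hconv, hconv]
  refine le_of_tendsto_of_tendsto
    ((((hlim r hrc).mul (hlim (fun t => r t * g t ^ 2) (by fun_prop))).sub
      ((hlim (fun t => r t * g t) (by fun_prop)).pow 2)).const_mul (k ^ 2))
    ((hlim r hrc).mul (hlim (fun t => r t * deriv g t ^ 2) (by fun_prop))) ?_
  have hev : ∀ᶠ τ : ℝ in nhdsWithin 0 (Set.Ioi 0), 0 < τ ∧ τ < (β - α) / 2 := by
    filter_upwards [Ioo_mem_nhdsGT (show (0 : ℝ) < (β - α) / 2 by linarith)] with τ hτ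
    exact hτ
  filter_upwards [hev] with τ hτ
  refine poincare_interval (by linarith) hk ?_ hr hr1 hg' hg1 ?_ ?_
  · refine lt_of_le_of_lt ?_ hL
    exact mul_le_mul_of_nonneg_left (by linarith) hk.le
  · intro t ht
    exact hIoo t ⟨by linarith [ht.1], by linarith [ht.2]⟩
  · intro t _
    exact hlc.mul_deriv2_le h0 hr hr1 t

/-- One-dimensional Brunn–Minkowski inequality for bounded convex sets. -/
lemma volume_convex_comb_le {I J S : Set ℝ} {a b : ℝ} (ha : 0 < a) (hb : 0 < b)
    (hI : Convex ℝ I) (hJ : Convex ℝ J) (hIn : I.Nonempty) (hJn : J.Nonempty)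
    (hIb : Bornology.IsBounded I) (hJb : Bornology.IsBounded J)
    (hS : ∀ x ∈ I, ∀ y ∈ J, a * x + b * y ∈ S) :
    ENNReal.ofReal a * volume I + ENNReal.ofReal b * volume J ≤ volume S := by
  have sub : ∀ {K : Set ℝ}, Bornology.IsBounded K → K ⊆ Set.Icc (sInf K) (sSup K) :=
    fun hK t ht => ⟨csInf_le hK.bddBelow ht, le_csSup hK.bddAbove ht⟩
  have le : ∀ {K : Set ℝ}, Bornology.IsBounded K → K.Nonempty → sInf K ≤ sSup K :=
    fun hK hn => csInf_le_csSup hn hK.bddBelow hK.bddAbove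
  have vol : ∀ {K : Set ℝ}, Bornology.IsBounded K →
      volume K ≤ ENNReal.ofReal (sSup K - sInf K) := fun hK =>
    (measure_mono (sub hK)).trans (by rw [Real.volume_Icc])
  have hsub : Set.Ioo (a * sInf I + b * sInf J) (a * sSup I + b * sSup J) ⊆ S := by
    intro z hz
    have h1 : ∃ x ∈ I, ∃ y ∈ J, a * x + b * y < z := by
      set e := z - (a * sInf I + b * sInf J) with he
      have hpos : 0 < e := by linarith [hz.1]
      obtain ⟨x, hx, hxe⟩ := exists_lt_of_csInf_lt hIn
        (show sInf I < sInf I + e / (2 * a) by have : 0 < e / (2 * a) := by positivity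
                                               linarith)
      obtain ⟨y, hy, hye⟩ := exists_lt_of_csInf_lt hJn
        (show sInf J < sInf J + e / (2 * b) by have : 0 < e / (2 * b) := by positivity
                                               linarith)
      refine ⟨x, hx, y, hy, ?_⟩
      have e1 := mul_lt_mul_of_pos_left hxe ha
      have e2 := mul_lt_mul_of_pos_left hye hb
      have e3 : a * (e / (2 * a)) = e / 2 := by field_simp
      have e4 : b * (e / (2 * b)) = e / 2 := by field_simp
      rw [mul_add, e3] at e1
      rw [mul_add, e4] at e2
      linarith
    have h2 : ∃ x ∈ I, ∃ y ∈ J, z < a * x + b * y := by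
      set e := (a * sSup I + b * sSup J) - z with he
      have hpos : 0 < e := by linarith [hz.2]
      obtain ⟨x, hx, hxe⟩ := exists_lt_of_lt_csSup hIn
        (show sSup I - e / (2 * a) < sSup I by have : 0 < e / (2 * a) := by positivity
                                               linarith)
      obtain ⟨y, hy, hye⟩ := exists_lt_of_lt_csSup hJn
        (show sSup J - e / (2 * b) < sSup J by have : 0 < e / (2 * b) := by positivity
                                               linarith)
      refine ⟨x, hx, y, hy, ?_⟩
      have e1 := mul_lt_mul_of_pos_left hxe ha
      have e2 := mul_lt_mul_of_pos_left hye hb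
      have e3 : a * (e / (2 * a)) = e / 2 := by field_simp
      have e4 : b * (e / (2 * b)) = e / 2 := by field_simp
      rw [mul_sub, e3] at e1
      rw [mul_sub, e4] at e2
      linarith
    obtain ⟨x1, hx1, y1, hy1, hz1⟩ := h1
    obtain ⟨x2, hx2, y2, hy2, hz2⟩ := h2
    set p := a * x1 + b * y1 with hp
    set q := a * x2 + b * y2 with hq
    set θ := (z - p) / (q - p) with hθ
    have hqp : 0 < q - p := by linarith
    have hθ0 : 0 ≤ θ := div_nonneg (by linarith) hqp.le
    have hθ1 : θ ≤ 1 := by rw [hθ, div_le_one hqp]; linarith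
    have hzθ : z = p + θ * (q - p) := by rw [hθ]; field_simp; ring
    have hx := hI hx1 hx2 (sub_nonneg.2 hθ1) hθ0 (by ring)
    have hy := hJ hy1 hy2 (sub_nonneg.2 hθ1) hθ0 (by ring)
    have := hS _ hx _ hy
    convert this using 1
    rw [hzθ, hp, hq]
    simp only [smul_eq_mul]
    ring
  calc _ ≤ ENNReal.ofReal a * ENNReal.ofReal (sSup I - sInf I)
        + ENNReal.ofReal b * ENNReal.ofReal (sSup J - sInf J) := by
        gcongr
        · exact vol hIb
        · exact vol hJb
    _ = volume (Set.Ioo (a * sInf I + b * sInf J) (a * sSup I + b * sSup J)) := by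
        rw [Real.volume_Ioo, ← ENNReal.ofReal_mul ha.le, ← ENNReal.ofReal_mul hb.le,
          ← ENNReal.ofReal_add (mul_nonneg ha.le (by linarith [le hIb hIn]))
            (mul_nonneg hb.le (by linarith [le hJb hJn]))]
        congr 1
        ring
    _ ≤ _ := measure_mono hsub

/-- Prékopa–Leindler on the line for functions with supremum one and convex superlevel sets. -/
lemma integral_convex_comb_le {f g h : ℝ → ℝ} {a b R : ℝ} (ha : 0 < a) (hb : 0 < b)
    (hab : a + b = 1) (hfi : Integrable f) (hgi : Integrable g) (hhi : Integrable h)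
    (hf0 : ∀ x, 0 ≤ f x) (hg0 : ∀ x, 0 ≤ g x) (hh0 : ∀ x, 0 ≤ h x)
    (hf1 : ∀ x, f x ≤ 1) (hg1 : ∀ x, g x ≤ 1)
    (hfs : ∀ t < 1, ∃ x, t < f x) (hgs : ∀ t < 1, ∃ x, t < g x)
    (hfc : ∀ t > 0, Convex ℝ {x | t < f x}) (hgc : ∀ t > 0, Convex ℝ {x | t < g x})
    (hfR : ∀ x, R < |x| → f x = 0) (hgR : ∀ x, R < |x| → g x = 0)
    (hfgh : ∀ x y, f x ^ a * g y ^ b ≤ h (a * x + b * y)) :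
    a * (∫ x, f x) + b * (∫ x, g x) ≤ ∫ x, h x := by
  have hbd : ∀ {f : ℝ → ℝ}, (∀ x, R < |x| → f x = 0) → ∀ t > (0 : ℝ),
      Bornology.IsBounded {x | t < f x} := by
    intro f hf t ht
    refine (Metric.isBounded_Icc (-R) R).subset fun x hx => ?_
    rw [Set.mem_Icc, ← abs_le]
    by_contra hn
    have := hf x (not_le.1 hn)
    simp only [Set.mem_ofPred_eq, this] at hx
    linarith
  have key : ∀ t ∈ Set.Ioi (0 : ℝ), ENNReal.ofReal a * volume {x | t < f x}
      + ENNReal.ofReal b * volume {x | t < g x} ≤ volume {x | t < h x} := by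
    intro t ht
    have ht0 : (0 : ℝ) < t := ht
    by_cases h1 : t < 1
    · refine volume_convex_comb_le ha hb (hfc t ht) (hgc t ht) (hfs t h1) (hgs t h1)
        (hbd hfR t ht) (hbd hgR t ht) fun x hx y hy => ?_
      refine lt_of_lt_of_le ?_ (hfgh x y)
      calc t = t ^ a * t ^ b := by rw [← rpow_add ht0, hab, rpow_one]
        _ < f x ^ a * g y ^ b := by
          have hx' : t < f x := hx
          have hy' : t < g y := hy
          gcongr
    · have e1 : {x | t < f x} = ∅ := by
        ext x; simp only [Set.mem_ofPred_eq, Set.mem_empty_iff_false, iff_false, not_lt]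
        exact (hf1 x).trans (not_lt.1 h1)
      have e2 : {x | t < g x} = ∅ := by
        ext x; simp only [Set.mem_ofPred_eq, Set.mem_empty_iff_false, iff_false, not_lt]
        exact (hg1 x).trans (not_lt.1 h1)
      simp [e1, e2]
  have hmeas : ∀ f : ℝ → ℝ, Measurable fun t : ℝ => volume {x | t < f x} := fun f =>
    Antitone.measurable fun s t hst => measure_mono fun x (hx : t < f x) => lt_of_le_of_lt hst hx
  have hl : ENNReal.ofReal a * (∫⁻ x, ENNReal.ofReal (f x))
      + ENNReal.ofReal b * (∫⁻ x, ENNReal.ofReal (g x)) ≤ ∫⁻ x, ENNReal.ofReal (h x) := by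
    rw [lintegral_eq_lintegral_meas_lt _ (Eventually.of_forall hf0) hfi.aemeasurable,
      lintegral_eq_lintegral_meas_lt _ (Eventually.of_forall hg0) hgi.aemeasurable,
      lintegral_eq_lintegral_meas_lt _ (Eventually.of_forall hh0) hhi.aemeasurable,
      ← lintegral_const_mul _ (hmeas f), ← lintegral_const_mul _ (hmeas g),
      ← lintegral_add_left ((hmeas f).const_mul _)]
    exact setLIntegral_mono' measurableSet_Ioi key
  rw [← ofReal_integral_eq_lintegral_ofReal hfi (Eventually.of_forall hf0),
    ← ofReal_integral_eq_lintegral_ofReal hgi (Eventually.of_forall hg0),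
    ← ofReal_integral_eq_lintegral_ofReal hhi (Eventually.of_forall hh0),
    ← ENNReal.ofReal_mul ha.le, ← ENNReal.ofReal_mul hb.le,
    ← ENNReal.ofReal_add (mul_nonneg ha.le (integral_nonneg hf0))
      (mul_nonneg hb.le (integral_nonneg hg0))] at hl
  exact (ENNReal.ofReal_le_ofReal_iff (integral_nonneg hh0)).1 hl

lemma integrable_of_bounded_support {f : ℝ → ℝ} {M R : ℝ} (hf : Measurable f)
    (hM : ∀ x, |f x| ≤ M) (hR : ∀ x, R < |x| → f x = 0) : Integrable f := by
  have h1 : IntegrableOn f (Set.Icc (-R) R) :=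
    Measure.integrableOn_of_bounded (M := M) (by simp) hf.aestronglyMeasurable
      (Eventually.of_forall fun x => hM x)
  refine h1.integrable_of_forall_notMem_eq_zero fun x hx => hR x ?_
  rw [Set.mem_Icc, ← abs_le] at hx
  exact not_le.1 hx

/-- Integrating out one real variable preserves log-concavity. -/
lemma LogConcave.integral_real {W : Type*} [AddCommGroup W] [Module ℝ W] {F : W × ℝ → ℝ}
    {M R : ℝ} (hF : LogConcave F) (h0 : ∀ p, 0 ≤ F p) (hM : ∀ p, F p ≤ M)
    (hR : ∀ w s, R < |s| → F (w, s) = 0) (hmeas : ∀ w, Measurable fun s => F (w, s)) :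
    LogConcave fun w => ∫ s, F (w, s) := by
  intro w z a b ha hb hab
  have hint : ∀ w, Integrable fun s => F (w, s) := fun w =>
    integrable_of_bounded_support (M := M) (hmeas w)
      (fun s => by rw [abs_of_nonneg (h0 _)]; exact hM _) (hR w)
  have hconv : ∀ w, ∀ t > 0, Convex ℝ {s | t < F (w, s)} := by
    intro w t ht
    rw [convex_iff_forall_pos]
    intro x hx y hy c d hc hd hcd
    have hx' : t < F (w, x) := hx
    have hy' : t < F (w, y) := hy
    have := hF (w, x) (w, y) c d hc hd hcd
    rw [Prod.smul_mk, Prod.smul_mk, Prod.mk_add_mk, ← add_smul, hcd, one_smul] at this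
    refine lt_of_lt_of_le ?_ this
    calc t = t ^ c * t ^ d := by rw [← rpow_add ht, hcd, rpow_one]
      _ < _ := by gcongr
  have hbdd : ∀ w, BddAbove (Set.range fun s => F (w, s)) := fun w =>
    ⟨M, by rintro _ ⟨s, rfl⟩; exact hM _⟩
  have hle : ∀ w s, F (w, s) ≤ ⨆ s, F (w, s) := fun w s => le_ciSup (hbdd w) s
  have hzero : ∀ w, (⨆ s, F (w, s)) ≤ 0 → ∫ s, F (w, s) = 0 := by
    intro w hw
    have : (fun s => F (w, s)) = fun _ => 0 := funext fun s =>
      le_antisymm ((hle w s).trans hw) (h0 _)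
    rw [this, integral_zero]
  simp only []
  set A := ⨆ s, F (w, s) with hA
  set B := ⨆ s, F (z, s) with hB
  by_cases hA0 : A ≤ 0
  · rw [hzero w hA0, zero_rpow ha.ne', zero_mul]
    exact integral_nonneg fun s => h0 _
  by_cases hB0 : B ≤ 0
  · rw [hzero z hB0, zero_rpow hb.ne', mul_zero]
    exact integral_nonneg fun s => h0 _
  push Not at hA0 hB0
  set D := A ^ a * B ^ b with hD
  have hD0 : 0 < D := mul_pos (rpow_pos_of_pos hA0 _) (rpow_pos_of_pos hB0 _)
  have hset : ∀ (w : W) (c : ℝ), 0 < c → ∀ t > 0, Convex ℝ {s | t < F (w, s) / c} := by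
    intro w c hc t ht
    have : {s | t < F (w, s) / c} = {s | t * c < F (w, s)} := by
      ext s; simp only [Set.mem_ofPred_eq, lt_div_iff₀ hc]
    rw [this]
    exact hconv w _ (mul_pos ht hc)
  have hsup : ∀ w, 0 < (⨆ s, F (w, s)) → ∀ t < 1, ∃ s, t < F (w, s) / ⨆ s, F (w, s) := by
    intro w hw t ht
    have : t * (⨆ s, F (w, s)) < ⨆ s, F (w, s) := by nlinarith
    obtain ⟨s, hs⟩ := exists_lt_of_lt_ciSup this
    exact ⟨s, by rwa [lt_div_iff₀ hw]⟩
  have key := integral_convex_comb_le (f := fun s => F (w, s) / A) (g := fun s => F (z, s) / B)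
    (h := fun s => F (a • w + b • z, s) / D) (R := R) ha hb hab
    ((hint w).div_const _) ((hint z).div_const _) ((hint _).div_const _)
    (fun s => div_nonneg (h0 _) hA0.le) (fun s => div_nonneg (h0 _) hB0.le)
    (fun s => div_nonneg (h0 _) hD0.le)
    (fun s => (div_le_one hA0).2 (hle w s)) (fun s => (div_le_one hB0).2 (hle z s))
    (hsup w hA0) (hsup z hB0) (hset w A hA0) (hset z B hB0)
    (fun s hs => by simp [hR w s hs]) (fun s hs => by simp [hR z s hs])
    (fun x y => by
      rw [div_rpow (h0 _) hA0.le, div_rpow (h0 _) hB0.le, div_mul_div_comm]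
      have := hF (w, x) (z, y) a b ha hb hab
      rw [Prod.smul_mk, Prod.smul_mk, Prod.mk_add_mk, smul_eq_mul, smul_eq_mul] at this
      exact div_le_div_of_nonneg_right this hD0.le)
  rw [integral_div, integral_div, integral_div] at key
  have hI : 0 ≤ ∫ s, F (w, s) := integral_nonneg fun s => h0 _
  have hJ : 0 ≤ ∫ s, F (z, s) := integral_nonneg fun s => h0 _
  have amgm := geom_mean_le_arith_mean2_weighted ha.le hb.le (div_nonneg hI hA0.le)
    (div_nonneg hJ hB0.le) hab
  have := amgm.trans key
  rw [div_rpow hI hA0.le, div_rpow hJ hB0.le, div_mul_div_comm] at this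
  exact (div_le_div_iff_of_pos_right hD0).1 this

/-- Integrating out finitely many real variables preserves log-concavity. -/
lemma LogConcave.integral_pi {n : ℕ} {R : ℝ} (hR0 : 0 ≤ R) : ∀ {M : ℝ}
    {F : (Fin n → ℝ) × ℝ → ℝ}, Measurable F → LogConcave F → (∀ p, 0 ≤ F p) →
    (∀ p, F p ≤ M) → (∀ x s, (∃ i, R < |x i|) → F (x, s) = 0) →
    LogConcave fun s => ∫ x, F (x, s) := by
  induction n with
  | zero =>
    intro M F hm hF h0 hM hR x y a b ha hb hab
    have e : ∀ s, ∫ x, F (x, s) = F (default, s) := by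
      intro s
      rw [Measure.volume_pi_eq_dirac (default : Fin 0 → ℝ), integral_dirac]
    simp only [e]
    have := hF (default, x) (default, y) a b ha hb hab
    rw [Prod.smul_mk, Prod.smul_mk, Prod.mk_add_mk] at this
    convert this
  | succ n ih =>
    intro M F hm hF h0 hM hR
    set H : ((Fin n → ℝ) × ℝ) × ℝ → ℝ := fun q =>
      F (Fin.insertNth (0 : Fin (n + 1)) (α := fun _ => ℝ) q.2 q.1.1, q.1.2) with hH
    have hins : Measurable fun q : ((Fin n → ℝ) × ℝ) × ℝ =>
        Fin.insertNth (0 : Fin (n + 1)) (α := fun _ => ℝ) q.2 q.1.1 :=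
      (MeasurableEquiv.piFinSuccAbove (fun _ => ℝ) 0).symm.measurable.comp
        (measurable_snd.prodMk (measurable_fst.comp measurable_fst))
    have hHm : Measurable H := hm.comp (hins.prodMk (measurable_snd.comp measurable_fst))
    have hHlc : LogConcave H := by
      intro p q a b ha hb hab
      refine (hF _ _ a b ha hb hab).trans_eq ?_
      simp only [hH]
      congr 1
      refine Prod.ext ?_ rfl
      funext i
      refine Fin.cases ?_ (fun i => ?_) i <;> simp
    have hHR : ∀ w s, R < |s| → H (w, s) = 0 := fun w s hs =>
      hR _ _ ⟨0, by simpa using hs⟩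
    have h1 : LogConcave fun w => ∫ s, H (w, s) :=
      hHlc.integral_real (fun _ => h0 _) (fun _ => hM _) hHR
        (fun w => hHm.comp (measurable_const.prodMk measurable_id))
    have h1m : Measurable fun w => ∫ s, H (w, s) :=
      (hHm.stronglyMeasurable.integral_prod_right').measurable
    have h1b : ∀ w, ∫ s, H (w, s) ≤ M * (2 * R) := by
      intro w
      have : ∫ s, H (w, s) = ∫ s in Set.Icc (-R) R, H (w, s) := by
        rw [setIntegral_eq_integral_of_forall_compl_eq_zero]
        intro s hs
        refine hHR w s ?_
        rw [Set.mem_Icc, ← abs_le] at hs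
        exact not_le.1 hs
      rw [this]
      have hb := norm_setIntegral_le_of_norm_le_const (μ := volume) (s := Set.Icc (-R) R)
        (f := fun s => H (w, s)) (C := M) (by simp)
        (fun s _ => by rw [Real.norm_eq_abs, abs_of_nonneg (h0 _)]; exact hM _)
      refine (le_abs_self _).trans (hb.trans_eq ?_)
      rw [Real.volume_real_Icc_of_le (by linarith)]
      ring
    have h2 := ih h1m h1 (fun _ => integral_nonneg fun _ => h0 _) h1b (by
      rintro x s ⟨i, hi⟩
      have : (fun t => H ((x, s), t)) = fun _ => 0 := funext fun t =>
        hR _ _ ⟨i.succ, by simpa using hi⟩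
      rw [this, integral_zero])
    convert h2 using 2 with s
    have hmp := (volume_preserving_piFinSuccAbove (fun _ : Fin (n + 1) => ℝ) 0).symm
    rw [← hmp.integral_comp (MeasurableEquiv.measurableEmbedding _), Measure.volume_eq_prod,
      integral_prod_symm]
    · rfl
    · set K : Set (ℝ × (Fin n → ℝ)) := Set.Icc (-R) R ×ˢ Set.Icc (fun _ => -R) (fun _ => R)
      have hK : IsCompact K := isCompact_Icc.prod isCompact_Icc
      set e := (MeasurableEquiv.piFinSuccAbove (fun _ : Fin (n + 1) => ℝ) 0).symm
      have hmeas : Measurable fun q : ℝ × (Fin n → ℝ) => F (e q, s) :=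
        hm.comp (e.measurable.prodMk measurable_const)
      have hint : IntegrableOn (fun q : ℝ × (Fin n → ℝ) => F (e q, s)) K
          ((volume : Measure ℝ).prod volume) :=
        Measure.integrableOn_of_bounded (M := M) hK.measure_lt_top.ne
          hmeas.aestronglyMeasurable
          (Eventually.of_forall fun q => by
            rw [Real.norm_eq_abs, abs_of_nonneg (h0 _)]; exact hM _)
      refine hint.integrable_of_forall_notMem_eq_zero fun q hq => hR _ _ ?_
      by_contra! hcon
      apply hq
      refine ⟨?_, ?_, ?_⟩
      · have := hcon 0
        exact abs_le.1 this
      · intro i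
        have := hcon i.succ
        exact (abs_le.1 this).1
      · intro i
        have := hcon i.succ
        exact (abs_le.1 this).2

/-- Integrating out a Euclidean variable preserves log-concavity. -/
lemma LogConcave.integral_euclidean {n : ℕ} {R M : ℝ} (hR0 : 0 ≤ R)
    {F : EuclideanSpace ℝ (Fin n) × ℝ → ℝ} (hm : Measurable F) (hF : LogConcave F)
    (h0 : ∀ p, 0 ≤ F p) (hM : ∀ p, F p ≤ M) (hR : ∀ x s, R < ‖x‖ → F (x, s) = 0) :
    LogConcave fun s => ∫ x, F (x, s) := by
  set e := MeasurableEquiv.toLp 2 (Fin n → ℝ)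
  have hmp : MeasurePreserving e := PiLp.volume_preserving_toLp (Fin n)
  have := LogConcave.integral_pi (n := n) hR0 (M := M)
    (F := fun q : (Fin n → ℝ) × ℝ => F (e q.1, q.2))
    (hm.comp ((e.measurable.comp measurable_fst).prodMk measurable_snd))
    (fun p q a b ha hb hab => hF (e p.1, p.2) (e q.1, q.2) a b ha hb hab)
    (fun _ => h0 _) (fun _ => hM _) (by
      rintro x s ⟨i, hi⟩
      refine hR _ _ (lt_of_lt_of_le hi ?_)
      exact PiLp.norm_apply_le (e x) i)
  convert this using 2 with s
  rw [← hmp.integral_comp e.measurableEmbedding]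

/-- The set of planes and points for which no half-space as in `exists_halfspace_cut` contains
three prescribed points is open. -/
lemma isOpen_setOf_separating {E : Type*} [NormedAddCommGroup E] [InnerProductSpace ℝ E]
    (x y z : E) :
    IsOpen {q : E × E × E | ∀ θ : ℝ, ¬ (0 ≤ ⟪cos θ • q.1 + sin θ • q.2.1, x - q.2.2⟫ ∧
      0 ≤ ⟪cos θ • q.1 + sin θ • q.2.1, y - q.2.2⟫ ∧
      0 ≤ ⟪cos θ • q.1 + sin θ • q.2.1, z - q.2.2⟫)} := by
  set C : Set (Set.Icc (-π) π × (E × E × E)) := {s |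
      0 ≤ ⟪cos s.1 • s.2.1 + sin s.1 • s.2.2.1, x - s.2.2.2⟫ ∧
      0 ≤ ⟪cos s.1 • s.2.1 + sin s.1 • s.2.2.1, y - s.2.2.2⟫ ∧
      0 ≤ ⟪cos s.1 • s.2.1 + sin s.1 • s.2.2.1, z - s.2.2.2⟫} with hC
  have hCc : IsClosed C := by
    have h : ∀ w : E, IsClosed {s : Set.Icc (-π) π × (E × E × E) |
        0 ≤ ⟪cos s.1 • s.2.1 + sin s.1 • s.2.2.1, w - s.2.2.2⟫} := fun w =>
      isClosed_le continuous_const (by fun_prop)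
    exact (h x).inter ((h y).inter (h z))
  have hproj := isClosedMap_snd_of_compactSpace C hCc
  rw [← isClosed_compl_iff]
  convert hproj using 1
  ext q
  simp only [Set.mem_compl_iff, Set.mem_ofPred_eq, not_forall, not_not, Set.mem_image, hC]
  constructor
  · rintro ⟨θ, hθ⟩
    refine ⟨(⟨toIocMod two_pi_pos (-π) θ, ?_⟩, q), ?_, rfl⟩
    · have := toIocMod_mem_Ioc two_pi_pos (-π) θ
      exact ⟨this.1.le, this.2.trans (by linarith)⟩
    · have e1 : cos (toIocMod two_pi_pos (-π) θ) = cos θ := by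
        rw [toIocMod, zsmul_eq_mul, cos_sub_int_mul_two_pi]
      have e2 : sin (toIocMod two_pi_pos (-π) θ) = sin θ := by
        rw [toIocMod, zsmul_eq_mul, sin_sub_int_mul_two_pi]
      simp only [e1, e2]
      exact hθ
  · rintro ⟨s, hs, rfl⟩
    exact ⟨s.1, hs⟩

section Localization

variable {E : Type*} [NormedAddCommGroup E] [InnerProductSpace ℝ E] [FiniteDimensional ℝ E]
  [MeasurableSpace E] [BorelSpace E]

lemma volume_hyperplane_eq_zero {c : E} (hc : c ≠ 0) (p : E) :
    volume {x : E | ⟪c, x - p⟫ = 0} = 0 := by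
  have hker : volume ((LinearMap.ker (innerSL ℝ c).toLinearMap : Submodule ℝ E) : Set E) = 0 := by
    apply Measure.addHaar_submodule
    intro htop
    have : c ∈ LinearMap.ker (innerSL ℝ c).toLinearMap := by rw [htop]; trivial
    exact hc (by simpa using this)
  have : {x : E | ⟪c, x - p⟫ = 0}
      = (fun x => x + -p) ⁻¹' (LinearMap.ker (innerSL ℝ c).toLinearMap : Submodule ℝ E) := by
    ext x
    simp [sub_eq_add_neg]
  rw [this, measure_preimage_add_right, hker]

/-- Two open half-spaces bounded by the same hyperplane split an integral. -/
lemma integral_inter_halfspace_add {c : E} (hc : c ≠ 0) (p : E) {K : Set E} {F : E → ℝ}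
    (hF : IntegrableOn F K) :
    (∫ x in K ∩ {x | 0 < ⟪c, x - p⟫}, F x) + ∫ x in K ∩ {x | 0 < ⟪-c, x - p⟫}, F x
      = ∫ x in K, F x := by
  have hm : MeasurableSet {x : E | 0 < ⟪c, x - p⟫} :=
    (isOpen_lt continuous_const (by fun_prop)).measurableSet
  rw [← integral_inter_add_sdiff hm hF]
  congr 1
  apply setIntegral_congr_set
  have hnull : ∀ᵐ x : E, ⟪c, x - p⟫ ≠ 0 := by
    rw [ae_iff]
    simpa using volume_hyperplane_eq_zero hc p
  filter_upwards [hnull] with x hx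
  apply propext
  change (x ∈ K ∧ 0 < ⟪-c, x - p⟫) ↔ (x ∈ K ∧ ¬ (0 < ⟪c, x - p⟫))
  rw [inner_neg_left, neg_pos, not_lt]
  exact and_congr_right fun _ => ⟨le_of_lt, fun h => lt_of_le_of_ne h hx⟩

/-- A convex set on which `F₁` has integral zero and `F₂` negative integral can be cut by a
half-space with normal in a prescribed plane, bounded by a hyperplane through a prescribed point,
so that both properties persist. -/
lemma exists_halfspace_cut {K : Set E} (hKo : IsOpen K) (hKc : Convex ℝ K) {F₁ F₂ : E → ℝ}
    (h₁ : IntegrableOn F₁ K) (h₂ : IntegrableOn F₂ K) (m₁ : ∫ x in K, F₁ x = 0)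
    (m₂ : ∫ x in K, F₂ x < 0) (a b p : E) :
    ∃ K' ⊆ K, IsOpen K' ∧ Convex ℝ K' ∧ (∫ x in K', F₁ x = 0) ∧ (∫ x in K', F₂ x < 0) ∧
      ∃ θ : ℝ, ∀ x ∈ K', 0 ≤ ⟪cos θ • a + sin θ • b, x - p⟫ := by
  set c : ℝ → E := fun θ => cos θ • a + sin θ • b with hc
  by_cases hdeg : ∃ θ, c θ = 0
  · obtain ⟨θ, hθ⟩ := hdeg
    refine ⟨K, subset_rfl, hKo, hKc, m₁, m₂, θ, fun x _ => ?_⟩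
    change 0 ≤ ⟪c θ, x - p⟫
    rw [hθ, inner_zero_left]
  push Not at hdeg
  have hcc : Continuous c := by fun_prop
  have hcπ : ∀ θ, c (θ + π) = -c θ := fun θ => by
    simp only [hc, cos_add_pi, sin_add_pi]; module
  set H : ℝ → Set E := fun θ => {x | 0 < ⟪c θ, x - p⟫} with hH
  have hHo : ∀ θ, IsOpen (H θ) := fun θ => isOpen_lt continuous_const (by fun_prop)
  have hHc : ∀ θ, Convex ℝ (H θ) := by
    intro θ
    have : H θ = {x | ⟪c θ, p⟫ < innerSL ℝ (c θ) x} := by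
      ext x
      simp [hH, inner_sub_right]
    rw [this]
    exact convex_halfSpace_gt (innerSL ℝ (c θ)).toLinearMap.isLinear _
  have hadd : ∀ F : E → ℝ, IntegrableOn F K → ∀ θ,
      (∫ x in K ∩ H θ, F x) + ∫ x in K ∩ H (θ + π), F x = ∫ x in K, F x := by
    intro F hF θ
    simp only [hH, hcπ]
    exact integral_inter_halfspace_add (hdeg θ) p hF
  have hM : Continuous fun θ => ∫ x in K ∩ H θ, F₁ x := by
    have e : (fun θ => ∫ x in K ∩ H θ, F₁ x) = fun θ => ∫ x in K, (H θ).indicator F₁ x := by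
      funext θ
      rw [setIntegral_indicator (hHo θ).measurableSet]
    rw [e, continuous_iff_continuousAt]
    intro θ
    refine continuousAt_of_dominated (bound := fun x => ‖F₁ x‖)
      (Eventually.of_forall fun θ =>
        h₁.aestronglyMeasurable.indicator (hHo θ).measurableSet)
      (Eventually.of_forall fun θ => Eventually.of_forall fun x =>
        norm_indicator_le_norm_self _ _) h₁.norm ?_
    have hnull : ∀ᵐ x ∂(volume.restrict K), ⟪c θ, x - p⟫ ≠ 0 := by
      apply ae_restrict_of_ae
      rw [ae_iff]
      simpa using volume_hyperplane_eq_zero (hdeg θ) p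
    filter_upwards [hnull] with x hx
    have hcont : Continuous fun θ => ⟪c θ, x - p⟫ := by fun_prop
    rcases lt_or_gt_of_ne hx with hlt | hgt
    · have : (fun θ => (H θ).indicator F₁ x) =ᶠ[nhds θ] fun _ => 0 := by
        filter_upwards [hcont.continuousAt.eventually_lt_const hlt] with θ' h'
        exact Set.indicator_of_notMem (s := H θ') (fun h => lt_asymm h' h) F₁
      exact this.continuousAt
    · have : (fun θ => (H θ).indicator F₁ x) =ᶠ[nhds θ] fun _ => F₁ x := by
        filter_upwards [hcont.continuousAt.eventually_const_lt hgt] with θ' h'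
        exact Set.indicator_of_mem (s := H θ') h' F₁
      exact this.continuousAt
  have hzero : ∃ θ, ∫ x in K ∩ H θ, F₁ x = 0 := by
    have h := hadd F₁ h₁ 0
    rw [m₁] at h
    rcases le_total (∫ x in K ∩ H 0, F₁ x) 0 with h0 | h0
    · exact mem_range_of_exists_le_of_exists_ge hM ⟨0, h0⟩ ⟨0 + π, by linarith⟩
    · exact mem_range_of_exists_le_of_exists_ge hM ⟨0 + π, by linarith⟩ ⟨0, h0⟩
  obtain ⟨θ, hθ⟩ := hzero
  have hθ' : ∫ x in K ∩ H (θ + π), F₁ x = 0 := by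
    have h := hadd F₁ h₁ θ
    rw [m₁, hθ, zero_add] at h
    exact h
  have h2 := hadd F₂ h₂ θ
  rcases lt_or_ge (∫ x in K ∩ H θ, F₂ x) 0 with hneg | hnn
  · exact ⟨K ∩ H θ, Set.inter_subset_left, hKo.inter (hHo _), hKc.inter (hHc _), hθ, hneg, θ,
      fun x hx => le_of_lt hx.2⟩
  · exact ⟨K ∩ H (θ + π), Set.inter_subset_left, hKo.inter (hHo _), hKc.inter (hHc _), hθ',
      by linarith, θ + π, fun x hx => le_of_lt hx.2⟩

/-- Localization: a convex set on which `F₁` has integral zero and `F₂` negative integral contains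
an arbitrarily thin convex set with the same properties. -/
lemma exists_thin_convex [Nontrivial E] {Ω : Set E} (hΩo : IsOpen Ω) (hΩc : Convex ℝ Ω)
    (hΩb : Bornology.IsBounded Ω) {F₁ F₂ : E → ℝ}
    (h₁ : IntegrableOn F₁ Ω) (h₂ : IntegrableOn F₂ Ω) (m₁ : ∫ x in Ω, F₁ x = 0)
    (m₂ : ∫ x in Ω, F₂ x < 0) {ε : ℝ} (hε : 0 < ε) :
    ∃ K ⊆ Ω, IsOpen K ∧ Convex ℝ K ∧ (∫ x in K, F₁ x = 0) ∧ (∫ x in K, F₂ x < 0) ∧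
      ∃ p e : E, ‖e‖ = 1 ∧ ∀ x ∈ K, ‖x - (p + ⟪e, x - p⟫ • e)‖ < ε := by
  obtain ⟨D, hD⟩ : ∃ D : ℕ → E × E × E, DenseRange D :=
    ⟨_, TopologicalSpace.denseRange_denseSeq _⟩
  let P : Set E → Prop := fun K => K ⊆ Ω ∧ IsOpen K ∧ Convex ℝ K ∧ (∫ x in K, F₁ x = 0) ∧
    (∫ x in K, F₂ x < 0)
  have hstep : ∀ K : {K // P K}, ∀ q : E × E × E, ∃ K' : {K // P K}, K'.1 ⊆ K.1 ∧
      ∃ θ : ℝ, ∀ x ∈ K'.1, 0 ≤ ⟪cos θ • q.1 + sin θ • q.2.1, x - q.2.2⟫ := by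
    rintro ⟨K, hKΩ, hKo, hKc, k1, k2⟩ q
    obtain ⟨K', hK', o, c, i1, i2, θ, hθ⟩ := exists_halfspace_cut hKo hKc (h₁.mono_set hKΩ)
      (h₂.mono_set hKΩ) k1 k2 q.1 q.2.1 q.2.2
    exact ⟨⟨K', hK'.trans hKΩ, o, c, i1, i2⟩, hK', θ, hθ⟩
  choose next hnext hθ using hstep
  let seq : ℕ → {K // P K} := fun i =>
    Nat.rec ⟨Ω, subset_rfl, hΩo, hΩc, m₁, m₂⟩ (fun i K => next K (D i)) i
  have hseq : ∀ i, seq (i + 1) = next (seq i) (D i) := fun i => rfl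
  have hanti : Antitone fun i => (seq i).1 := antitone_nat_of_succ_le fun i => by
    simp only [hseq]
    exact hnext _ _
  have hne : ∀ i, (seq i).1.Nonempty := by
    intro i
    by_contra h
    have := (seq i).2.2.2.2.2
    rw [Set.not_nonempty_iff_eq_empty.1 h] at this
    simp at this
  set V : ℕ → Set E := fun i => closure (seq i).1 with hV
  have hVanti : Antitone V := fun i j hij => closure_mono (hanti hij)
  have hVc : ∀ i, IsCompact (V i) := fun i =>
    (hΩb.subset (seq i).2.1).isCompact_closure
  set L := ⋂ i, V i with hL
  have hLne : L.Nonempty := IsCompact.nonempty_iInter_of_sequence_nonempty_isCompact_isClosed V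
    (fun i => hVanti (Nat.le_succ i)) (fun i => (hne i).closure) (hVc 0)
    (fun i => isClosed_closure)
  have hLsep : ∀ x ∈ L, ∀ y ∈ L, ∀ z ∈ L, ∀ i, ∃ θ : ℝ,
      0 ≤ ⟪cos θ • (D i).1 + sin θ • (D i).2.1,
        x - (D i).2.2⟫ ∧
      0 ≤ ⟪cos θ • (D i).1 + sin θ • (D i).2.1,
        y - (D i).2.2⟫ ∧
      0 ≤ ⟪cos θ • (D i).1 + sin θ • (D i).2.1,
        z - (D i).2.2⟫ := by
    intro x hx y hy z hz i
    obtain ⟨θ, h⟩ := hθ (seq i) (D i)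
    rw [← hseq] at h
    have hcl : ∀ x ∈ L, 0 ≤ ⟪cos θ • (D i).1
        + sin θ • (D i).2.1, x - (D i).2.2⟫ := by
      intro x hx
      exact closure_minimal (t := {x | 0 ≤ ⟪cos θ • (D i).1
        + sin θ • (D i).2.1, x - (D i).2.2⟫}) h
        (isClosed_le continuous_const (by fun_prop)) (Set.mem_iInter.1 hx (i + 1))
    exact ⟨θ, hcl x hx, hcl y hy, hcl z hz⟩
  have hdep : ∀ x ∈ L, ∀ y ∈ L, ∀ z ∈ L, ∃ s t : ℝ, (s ≠ 0 ∨ t ≠ 0) ∧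
      s • (y - x) + t • (z - x) = 0 := by
    intro x hx y hy z hz
    by_contra! hcon
    have hopen := isOpen_setOf_separating x y z
    obtain ⟨i, hi⟩ := hD.exists_mem_open hopen
      ⟨(y - x, z - x, (3⁻¹ : ℝ) • (x + y + z)), by
        rintro θ ⟨hx0, hy0, hz0⟩
        simp only at hx0 hy0 hz0
        set c := cos θ • (y - x) + sin θ • (z - x) with hc
        set p := (3⁻¹ : ℝ) • (x + y + z) with hp
        have hsum : ⟪c, x - p⟫ + ⟪c, y - p⟫ + ⟪c, z - p⟫ = 0 := by
          rw [← inner_add_right, ← inner_add_right]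
          have : x - p + (y - p) + (z - p) = 0 := by rw [hp]; module
          rw [this, inner_zero_right]
        have hyx : ⟪c, y - x⟫ = 0 := by
          have : y - x = (y - p) - (x - p) := by abel
          rw [this, inner_sub_right]
          linarith
        have hzx : ⟪c, z - x⟫ = 0 := by
          have : z - x = (z - p) - (x - p) := by abel
          rw [this, inner_sub_right]
          linarith
        have hc0 : c = 0 := by
          rw [← inner_self_eq_zero (𝕜 := ℝ)]
          nth_rewrite 2 [hc]
          rw [inner_add_right, inner_smul_right, inner_smul_right, hyx, hzx]
          simp
        refine hcon (cos θ) (sin θ) ?_ hc0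
        by_contra! h
        have := sin_sq_add_cos_sq θ
        rw [h.1, h.2] at this
        norm_num at this⟩
    obtain ⟨θ, hθ⟩ := hLsep x hx y hy z hz i
    exact hi θ hθ
  have hline : ∃ p e : E, ‖e‖ = 1 ∧ ∀ x ∈ L, x = p + ⟪e, x - p⟫ • e := by
    obtain ⟨p, hp⟩ := hLne
    by_cases hsub : ∃ y ∈ L, y ≠ p
    · obtain ⟨y, hy, hyp⟩ := hsub
      have hd : y - p ≠ 0 := sub_ne_zero.2 hyp
      have hn : ‖y - p‖ ≠ 0 := norm_ne_zero_iff.2 hd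
      refine ⟨p, ‖y - p‖⁻¹ • (y - p), norm_smul_inv_norm hd, fun z hz => ?_⟩
      obtain ⟨s, t, hst, h⟩ := hdep p hp y hy z hz
      have ht : t ≠ 0 := by
        rintro rfl
        rw [zero_smul, add_zero, smul_eq_zero] at h
        simp [hd] at hst h
        exact hst h
      have hz' : z - p = (-(s / t)) • (y - p) := by
        have : t • (z - p) = -(s • (y - p)) := by
          rw [eq_neg_iff_add_eq_zero, add_comm]; exact h
        calc z - p = t⁻¹ • (t • (z - p)) := by rw [smul_smul, inv_mul_cancel₀ ht, one_smul]
          _ = _ := by rw [this, smul_neg, smul_smul, neg_smul]; congr 2; ring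
      rw [hz', inner_smul_left, inner_smul_right, real_inner_self_eq_norm_sq, smul_smul]
      have : (starRingEnd ℝ) ‖y - p‖⁻¹ * (-(s / t) * ‖y - p‖ ^ 2) * ‖y - p‖⁻¹ = -(s / t) := by
        simp only [conj_trivial]
        field_simp
      rw [this, ← hz']
      abel
    · push Not at hsub
      obtain ⟨e, he⟩ := exists_norm_eq E (zero_le_one (α := ℝ))
      refine ⟨p, e, he, fun z hz => ?_⟩
      rw [hsub z hz]
      simp
  obtain ⟨p, e, he, hline⟩ := hline
  have hU : IsOpen {x : E | ‖x - (p + ⟪e, x - p⟫ • e)‖ < ε} :=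
    isOpen_lt (by fun_prop) continuous_const
  obtain ⟨i, hi⟩ := exists_subset_nhds_of_isCompact (V := V) (hVanti.directed_ge) hVc
    (U := {x : E | ‖x - (p + ⟪e, x - p⟫ • e)‖ < ε}) (fun x hx => hU.mem_nhds (by
      change ‖x - (p + ⟪e, x - p⟫ • e)‖ < ε
      rw [← hline x hx, sub_self, norm_zero]
      exact hε))
  exact ⟨(seq i).1, (seq i).2.1, (seq i).2.2.1, (seq i).2.2.2.1, (seq i).2.2.2.2.1,
    (seq i).2.2.2.2.2, p, e, he, fun x hx => hi (subset_closure hx)⟩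

end Localization

lemma expNegInvGlue_logConcave : LogConcave expNegInvGlue := by
  intro x y a b ha hb hab
  rcases le_or_gt x 0 with hx | hx
  · rw [expNegInvGlue.zero_of_nonpos hx, zero_rpow ha.ne', zero_mul]
    exact expNegInvGlue.nonneg _
  rcases le_or_gt y 0 with hy | hy
  · rw [expNegInvGlue.zero_of_nonpos hy, zero_rpow hb.ne', mul_zero]
    exact expNegInvGlue.nonneg _
  have hz : 0 < a • x + b • y := by simp only [smul_eq_mul]; positivity
  simp only [expNegInvGlue, not_le.2 hx, not_le.2 hy, not_le.2 hz, if_false]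
  rw [← exp_mul, ← exp_mul, ← exp_add, exp_le_exp]
  have := (convexOn_zpow (𝕜 := ℝ) (-1)).2 hx hy ha.le hb.le hab
  simp only [smul_eq_mul, zpow_neg_one] at this ⊢
  linarith

/-- There is a smooth log-concave probability density supported in `[-ε, ε]`. -/
lemma exists_logConcave_bump {ε : ℝ} (hε : 0 < ε) :
    ∃ b : ℝ → ℝ, ContDiff ℝ 2 b ∧ (∀ s, 0 ≤ b s) ∧ LogConcave b ∧ (∀ s, ε < |s| → b s = 0) ∧
      ∫ s, b s = 1 := by
  set h : ℝ → ℝ := fun s => expNegInvGlue (1 - (s / ε) ^ 2) with hh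
  have hC : ContDiff ℝ 2 h := expNegInvGlue.contDiff.comp (by fun_prop)
  have h0 : ∀ s, 0 ≤ h s := fun s => expNegInvGlue.nonneg _
  have hsupp : ∀ s, ε < |s| → h s = 0 := by
    intro s hs
    apply expNegInvGlue.zero_of_nonpos
    have : 1 ≤ (s / ε) ^ 2 := by
      rw [one_le_sq_iff_one_le_abs, abs_div, abs_of_pos hε, one_le_div hε]
      exact hs.le
    linarith
  have hcs : HasCompactSupport h := HasCompactSupport.intro (isCompact_Icc (a := -ε) (b := ε))
    fun s hs => hsupp s (by
      by_contra hcon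
      exact hs (abs_le.1 (not_lt.1 hcon)))
  have hpos : 0 < ∫ s, h s := by
    apply hC.continuous.integral_pos_of_hasCompactSupport_nonneg_nonzero hcs h0 (x := 0)
    simp only [hh]
    exact (expNegInvGlue.pos_of_pos (by norm_num)).ne'
  have hlc : LogConcave h := by
    intro x y a b ha hb hab
    refine (expNegInvGlue_logConcave _ _ a b ha hb hab).trans ?_
    apply expNegInvGlue.monotone
    have hb' : b = 1 - a := by linarith
    simp only [smul_eq_mul]
    have e : (a * x + b * y) / ε = a * (x / ε) + b * (y / ε) := by ring
    rw [e]
    have : 0 ≤ a * b * (x / ε - y / ε) ^ 2 := by positivity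
    subst hb'
    nlinarith
  set c := (∫ s, h s)⁻¹ with hc
  have hcpos : 0 < c := inv_pos.2 hpos
  refine ⟨fun s => c * h s, contDiff_const.mul hC, fun s => mul_nonneg hcpos.le (h0 s), ?_,
    fun s hs => by simp only [hsupp s hs, mul_zero], ?_⟩
  · refine LogConcave.mul ?_ hlc (fun _ => hcpos.le) h0
    intro x y a b _ _ hab
    rw [← rpow_add hcpos, hab, rpow_one]
  · rw [integral_const_mul, hc, inv_mul_cancel₀ hpos.ne']

section Thin

variable {E : Type*} [NormedAddCommGroup E] [InnerProductSpace ℝ E] [FiniteDimensional ℝ E]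
  [MeasurableSpace E] [BorelSpace E]

lemma integrable_bump_prod {μ : Measure E} [IsFiniteMeasure μ] {T : E → ℝ} (hT : Continuous T)
    {b : ℝ → ℝ} (hb : Integrable b) {H : ℝ → ℝ} (hH : Continuous H) {M : ℝ}
    (hM : ∀ s, |H s| ≤ M) :
    Integrable (fun q : ℝ × E => b (q.1 - T q.2) * H q.1) (volume.prod μ) := by
  have h1 : Integrable (fun q : E × ℝ => b (q.2 - T q.1)) (μ.prod volume) := by
    rw [integrable_prod_iff]
    · constructor
      · exact Eventually.of_forall fun x => hb.comp_sub_right (T x)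
      · have : (fun x : E => ∫ s, ‖b (s - T x)‖) = fun _ => ∫ s, ‖b s‖ := by
          funext x
          exact integral_sub_right_eq_self (fun s => ‖b s‖) (T x)
        simp only [this]
        exact integrable_const _
    · have hshear : MeasurePreserving (fun q : E × ℝ => (q.1, q.2 - T q.1)) (μ.prod volume)
          (μ.prod volume) :=
        (MeasurePreserving.id μ).skew_product (g := fun x s => s - T x) (by fun_prop)
          (Eventually.of_forall fun x => (measurePreserving_sub_right volume (T x)).map_eq)
      exact (hb.aestronglyMeasurable.comp_snd (μ := μ)).comp_measurePreserving hshear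
  refine h1.swap.mul_bdd (c := M) ?_ ?_
  · exact (hH.comp continuous_fst).aestronglyMeasurable
  · exact Eventually.of_forall fun q => hM q.1

/-- Integrals against the smoothed marginal of a measure concentrated near a line approximate the
integrals against the measure. -/
lemma abs_integral_marginal_sub_le {μ : Measure E} [IsFiniteMeasure μ] {p e : E} (he : ‖e‖ = 1)
    {ε : ℝ} (hthin : ∀ᵐ x ∂μ, ‖x - (p + ⟪e, x - p⟫ • e)‖ < ε) {b : ℝ → ℝ} (hbi : Integrable b)
    (hb0 : ∀ s, 0 ≤ b s) (hbs : ∀ s, ε < |s| → b s = 0) (hb1 : ∫ s, b s = 1) {Q : E → ℝ}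
    (hQ : Continuous Q) {M η : ℝ} (hM : ∀ x, |Q x| ≤ M)
    (hη : ∀ x y, ‖x - y‖ ≤ 2 * ε → |Q x - Q y| ≤ η) :
    |(∫ s, (∫ x, b (s - ⟪e, x - p⟫) ∂μ) * Q (p + s • e)) - ∫ x, Q x ∂μ| ≤ η * μ.real Set.univ := by
  have hprod := integrable_bump_prod (μ := μ) (T := fun x => ⟪e, x - p⟫) (by fun_prop) hbi
    (H := fun s => Q (p + s • e)) (by fun_prop) (fun s => hM _)
  have hfub : ∫ s, (∫ x, b (s - ⟪e, x - p⟫) ∂μ) * Q (p + s • e)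
      = ∫ x, (∫ s, b (s - ⟪e, x - p⟫) * Q (p + s • e)) ∂μ := by
    rw [← integral_integral_swap hprod]
    refine integral_congr_ae (Eventually.of_forall fun s => ?_)
    simp only [integral_mul_const]
  have hQi : Integrable Q μ := Integrable.of_bound hQ.aestronglyMeasurable M
    (Eventually.of_forall hM)
  rw [hfub, ← integral_sub hprod.integral_prod_right hQi]
  have hpt : ∀ᵐ x ∂μ, ‖(∫ s, b (s - ⟪e, x - p⟫) * Q (p + s • e)) - Q x‖ ≤ η := by
    filter_upwards [hthin] with x hx
    set t := ⟪e, x - p⟫ with ht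
    have hbt : Integrable fun s => b (s - t) := hbi.comp_sub_right t
    have hbQ : Integrable fun s => b (s - t) * Q (p + s • e) :=
      hbt.mul_bdd (c := M) (by fun_prop) (Eventually.of_forall fun s => hM _)
    have h1 : ∫ s, b (s - t) = 1 := by rw [integral_sub_right_eq_self b t, hb1]
    have e1 : (∫ s, b (s - t) * Q (p + s • e)) - Q x
        = ∫ s, b (s - t) * (Q (p + s • e) - Q x) := by
      simp only [mul_sub]
      rw [integral_sub hbQ (hbt.mul_const _), integral_mul_const, h1, one_mul]
    rw [e1]
    calc _ ≤ ∫ s, b (s - t) * η := by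
          refine norm_integral_le_of_norm_le (hbt.mul_const _) (Eventually.of_forall fun s => ?_)
          rw [norm_mul, norm_of_nonneg (hb0 _)]
          rcases lt_or_ge ε |s - t| with hs | hs
          · simp [hbs _ hs]
          · refine mul_le_mul_of_nonneg_left (hη _ _ ?_) (hb0 _)
            have : p + s • e - x = (s - t) • e - (x - (p + t • e)) := by module
            rw [this]
            refine (norm_sub_le _ _).trans ?_
            rw [norm_smul, he, norm_eq_abs]
            linarith
      _ = η := by rw [integral_mul_const, h1, one_mul]
  calc _ ≤ ∫ x, η ∂μ := norm_integral_le_of_norm_le (integrable_const _) hpt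
    _ = _ := by simp [mul_comm]

/-- Approximate Poincaré inequality for a measure concentrated near a line. -/
lemma thin_poincare {μ : Measure E} [IsFiniteMeasure μ] {p e : E} (he : ‖e‖ = 1)
    {ε : ℝ} (hthin : ∀ᵐ x ∂μ, ‖x - (p + ⟪e, x - p⟫ • e)‖ < ε) {A B k : ℝ}
    (hAB : ∀ᵐ x ∂μ, ⟪e, x - p⟫ ∈ Set.Icc A B) (hk : 0 < k) (hkL : k * (B - A + 2 * ε) < π)
    {b : ℝ → ℝ} (hbC : ContDiff ℝ 2 b)
    (hb0 : ∀ s, 0 ≤ b s) (hbs : ∀ s, ε < |s| → b s = 0) (hb1 : ∫ s, b s = 1)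
    (hlc : LogConcave fun s => ∫ x, b (s - ⟪e, x - p⟫) ∂μ)
    {f : E → ℝ} (hf : ContDiff ℝ 1 f) {M η : ℝ} (hM : ∀ x, |f x| ≤ M)
    (hM2 : ∀ x, |f x ^ 2| ≤ M) (hM' : ∀ x, |‖fderiv ℝ f x‖ ^ 2| ≤ M)
    (hη : ∀ x y, ‖x - y‖ ≤ 2 * ε → |f x - f y| ≤ η)
    (hη2 : ∀ x y, ‖x - y‖ ≤ 2 * ε → |f x ^ 2 - f y ^ 2| ≤ η)
    (hη' : ∀ x y, ‖x - y‖ ≤ 2 * ε → |‖fderiv ℝ f x‖ ^ 2 - ‖fderiv ℝ f y‖ ^ 2| ≤ η)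
    (hmean : ∫ x, f x ∂μ = 0) :
    k ^ 2 * ∫ x, f x ^ 2 ∂μ
      ≤ (∫ x, ‖fderiv ℝ f x‖ ^ 2 ∂μ) + (η + k ^ 2 * η + k ^ 2 * η ^ 2) * μ.real Set.univ := by
  have hcs : HasCompactSupport b := HasCompactSupport.intro (isCompact_Icc (a := -ε) (b := ε))
    fun s hs => hbs s (by
      by_contra hcon
      exact hs (abs_le.1 (not_lt.1 hcon)))
  have hbi : Integrable b := hbC.continuous.integrable_of_hasCompactSupport hcs
  have happ := fun {Q : E → ℝ} (hQ : Continuous Q) {M η : ℝ} (hM : ∀ x, |Q x| ≤ M)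
    (hη : ∀ x y, ‖x - y‖ ≤ 2 * ε → |Q x - Q y| ≤ η) =>
    abs_integral_marginal_sub_le he hthin hbi hb0 hbs hb1 hQ hM hη
  set ρ : ℝ → ℝ := fun s => ∫ x, b (s - ⟪e, x - p⟫) ∂μ with hρ
  set N := μ.real Set.univ with hN
  have hTm : Measurable fun x : E => ⟪e, x - p⟫ := by fun_prop
  have hρC : ContDiff ℝ 2 ρ := by
    have e1 : ρ = MeasureTheory.convolution (fun _ => (1 : ℝ)) b (ContinuousLinearMap.mul ℝ ℝ)
        (μ.map fun x => ⟪e, x - p⟫) := by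
      funext s
      rw [convolution_def, integral_map hTm.aemeasurable]
      · simp [hρ]
      · exact (by fun_prop : Continuous fun t => (ContinuousLinearMap.mul ℝ ℝ) 1 (b (s - t))
          ).aestronglyMeasurable
    rw [e1]
    exact hcs.contDiff_convolution_right _ (integrable_const _).locallyIntegrable hbC
  have hρ0 : ∀ s, 0 ≤ ρ s := fun s => integral_nonneg fun x => hb0 _
  have hρs : ∀ t, t ∉ Set.Icc (A - ε) (B + ε) → ρ t = 0 := by
    intro t ht
    apply integral_eq_zero_of_ae
    filter_upwards [hAB] with x hx
    apply hbs
    by_contra hcon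
    have := abs_le.1 (not_lt.1 hcon)
    exact ht ⟨by linarith [hx.1, this.1], by linarith [hx.2, this.2]⟩
  have hρcs : HasCompactSupport ρ := HasCompactSupport.intro isCompact_Icc hρs
  have hg : ContDiff ℝ 1 fun s : ℝ => f (p + s • e) := hf.comp (by fun_prop)
  have hpl := poincare_line hk (A := A - ε) (B := B + ε) (by linarith) hρC hρ0 hlc hρs hg
  have i0 : ∫ s, ρ s = N := by
    have := happ (Q := fun _ => 1) continuous_const (M := 1) (η := 0) (by simp) (by simp)
    simp only [mul_one, zero_mul, abs_nonpos_iff, integral_const, smul_eq_mul] at this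
    linarith
  have i1 := happ hf.continuous hM hη
  have i2 := happ (by fun_prop : Continuous fun x => f x ^ 2) hM2 hη2
  have i3 := happ (((hf.continuous_fderiv one_ne_zero).norm).pow 2) hM' hη'
  have hder : ∀ s, deriv (fun s : ℝ => f (p + s • e)) s ^ 2 ≤ ‖fderiv ℝ f (p + s • e)‖ ^ 2 := by
    intro s
    have hl : HasDerivAt (fun s : ℝ => p + s • e) e s := by
      simpa using ((hasDerivAt_id s).smul_const e).const_add p
    have := ((hf.differentiable one_ne_zero (p + s • e)).hasFDerivAt).comp_hasDerivAt s hl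
    rw [show deriv (fun s : ℝ => f (p + s • e)) s = _ from this.deriv, ← sq_abs]
    refine pow_le_pow_left₀ (abs_nonneg _) ?_ 2
    have := (fderiv ℝ f (p + s • e)).le_opNorm e
    rwa [he, mul_one] at this
  have i4 : ∫ s, ρ s * deriv (fun s : ℝ => f (p + s • e)) s ^ 2
      ≤ ∫ s, ρ s * ‖fderiv ℝ f (p + s • e)‖ ^ 2 := by
    have hc1 : Continuous fun s => deriv (fun s : ℝ => f (p + s • e)) s :=
      hg.continuous_deriv le_rfl
    have hc2 : Continuous fun s : ℝ => fderiv ℝ f (p + s • e) :=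
      (hf.continuous_fderiv one_ne_zero).comp (by fun_prop)
    refine integral_mono ?_ ?_ fun s => mul_le_mul_of_nonneg_left (hder s) (hρ0 s)
    · exact (hρC.continuous.mul (hc1.pow 2)).integrable_of_hasCompactSupport hρcs.mul_right
    · exact (hρC.continuous.mul (hc2.norm.pow 2)).integrable_of_hasCompactSupport hρcs.mul_right
  rw [i0] at hpl
  rw [hmean, sub_zero] at i1
  have hN0 : 0 ≤ N := measureReal_nonneg
  rcases hN0.eq_or_lt with hz | hpos
  · have hμ : μ = 0 := by
      rw [← Measure.measure_univ_eq_zero]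
      exact (measureReal_eq_zero_iff).1 hz.symm
    simp [hμ, ← hz]
  have i1' : (∫ s, ρ s * f (p + s • e)) ^ 2 ≤ (η * N) ^ 2 := by
    rw [← sq_abs]
    exact pow_le_pow_left₀ (abs_nonneg _) i1 2
  have i2' := (abs_le.1 i2).1
  have i3' : (∫ s, ρ s * ‖fderiv ℝ f (p + s • e)‖ ^ 2) - ∫ x, ‖fderiv ℝ f x‖ ^ 2 ∂μ ≤ η * N :=
    (abs_le.1 i3).2
  have hk2 : 0 < k ^ 2 := by positivity
  refine le_of_mul_le_mul_left ?_ hpos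
  have a1 : k ^ 2 * (N * ((∫ x, f x ^ 2 ∂μ) - η * N) - (η * N) ^ 2)
      ≤ N * ((∫ x, ‖fderiv ℝ f x‖ ^ 2 ∂μ) + η * N) := by
    refine le_trans (mul_le_mul_of_nonneg_left ?_ hk2.le) (hpl.trans ?_)
    · have := mul_le_mul_of_nonneg_left (show (∫ x, f x ^ 2 ∂μ) - η * N
        ≤ ∫ s, ρ s * f (p + s • e) ^ 2 by linarith) hN0
      linarith
    · exact mul_le_mul_of_nonneg_left (by linarith) hN0
  nlinarith [a1]

end Thin

lemma LogConcave.indicator {V : Type*} [AddCommGroup V] [Module ℝ V] {F : V → ℝ}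
    (hF : LogConcave F) (h0 : ∀ x, 0 ≤ F x) {K : Set V} (hK : Convex ℝ K) :
    LogConcave (K.indicator F) := by
  intro x y a b ha hb hab
  have hnn : 0 ≤ K.indicator F (a • x + b • y) := Set.indicator_nonneg (fun x _ => h0 x) _
  by_cases hx : x ∈ K
  · by_cases hy : y ∈ K
    · rw [Set.indicator_of_mem hx, Set.indicator_of_mem hy,
        Set.indicator_of_mem (hK hx hy ha.le hb.le hab)]
      exact hF x y a b ha hb hab
    · rwa [Set.indicator_of_notMem hy, zero_rpow hb.ne', mul_zero]
  · rwa [Set.indicator_of_notMem hx, zero_rpow ha.ne', zero_mul]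

/-- The smoothed one-dimensional marginal of a log-concave density on a convex set is
log-concave. -/
lemma LogConcave.smoothed_marginal {n : ℕ} {K : Set (EuclideanSpace ℝ (Fin n))}
    (hKm : MeasurableSet K) (hKc : Convex ℝ K) (hKb : Bornology.IsBounded K)
    {W : EuclideanSpace ℝ (Fin n) → ℝ} (hWm : Measurable W) (hW0 : ∀ x, 0 ≤ W x) {M : ℝ}
    (hWM : ∀ x, W x ≤ M) (hWlc : LogConcave W) (p e : EuclideanSpace ℝ (Fin n)) {b : ℝ → ℝ}
    (hbc : Continuous b) (hb0 : ∀ s, 0 ≤ b s) {Mb : ℝ} (hbM : ∀ s, b s ≤ Mb)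
    (hblc : LogConcave b) :
    LogConcave fun s => ∫ x in K, W x * b (s - ⟪e, x - p⟫) := by
  obtain ⟨R, hR⟩ := hKb.subset_closedBall 0
  have hM0 : 0 ≤ M := (hW0 0).trans (hWM 0)
  have hind0 : ∀ x, 0 ≤ K.indicator W x := fun x => Set.indicator_nonneg (fun x _ => hW0 x) _
  have key := LogConcave.integral_euclidean (R := max R 0) (M := M * Mb) (le_max_right _ _)
    (F := fun q : EuclideanSpace ℝ (Fin n) × ℝ => K.indicator W q.1 * b (q.2 - ⟪e, q.1 - p⟫))
    ?_ ?_ ?_ ?_ ?_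
  · convert key using 2 with s
    rw [← integral_indicator hKm]
    congr 1
    funext x
    by_cases hx : x ∈ K
    · simp only [Set.indicator_of_mem hx]
    · simp only [Set.indicator_of_notMem hx, zero_mul]
  · exact ((hWm.indicator hKm).comp measurable_fst).mul
      (hbc.comp (by fun_prop : Continuous fun q : EuclideanSpace ℝ (Fin n) × ℝ =>
        q.2 - ⟪e, q.1 - p⟫)).measurable
  · refine LogConcave.mul
      ((hWlc.indicator hW0 hKc).comp_linear (LinearMap.fst ℝ (EuclideanSpace ℝ (Fin n)) ℝ)) ?_
      (fun q => hind0 _) fun q => hb0 _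
    intro q q' α β hα hβ hαβ
    refine (hblc _ _ α β hα hβ hαβ).trans_eq ?_
    congr 1
    simp only [Prod.fst_add, Prod.snd_add, Prod.smul_fst, Prod.smul_snd, inner_sub_right,
      inner_add_right, inner_smul_right, smul_eq_mul]
    linear_combination (inner ℝ e p) * hαβ
  · exact fun q => mul_nonneg (hind0 _) (hb0 _)
  · intro q
    refine mul_le_mul ?_ (hbM _) (hb0 _) hM0
    exact Set.indicator_apply_le' (fun _ => hWM _) fun _ => hM0
  · intro x s hx
    have : x ∉ K := fun h => by
      have := mem_closedBall_zero_iff.1 (hR h)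
      exact absurd (lt_of_le_of_lt (le_max_left R 0) hx) (not_lt.2 this)
    simp [Set.indicator_of_notMem this]

/-- Weighted Poincaré inequality with a non-sharp constant. -/
lemma weighted_poincare_of_lt {n : ℕ} [Nontrivial (EuclideanSpace ℝ (Fin n))]
    {Ω : Set (EuclideanSpace ℝ (Fin n))} (hΩo : IsOpen Ω) (hΩb : Bornology.IsBounded Ω)
    (hΩc : Convex ℝ Ω) {W : EuclideanSpace ℝ (Fin n) → ℝ} (hWm : Measurable W)
    (hW0 : ∀ x, 0 ≤ W x) {M : ℝ} (hWM : ∀ x, W x ≤ M) (hWlc : LogConcave W)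
    {v : EuclideanSpace ℝ (Fin n) → ℝ} (hv : ContDiff ℝ 1 v) (hvc : HasCompactSupport v) {c : ℝ}
    (hc : ∫ x in Ω, (v x - c) * W x = 0) {k : ℝ} (hk : 0 < k) (hkd : k * Metric.diam Ω < π) :
    k ^ 2 * ∫ x in Ω, (v x - c) ^ 2 * W x ≤ ∫ x in Ω, ‖fderiv ℝ v x‖ ^ 2 * W x := by
  set f := fun x => v x - c with hf
  have hfC : ContDiff ℝ 1 f := hv.sub contDiff_const
  have hfd : fderiv ℝ f = fderiv ℝ v := by
    funext x
    exact fderiv_sub_const c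
  have hvd : HasCompactSupport fun x => ‖fderiv ℝ v x‖ ^ 2 := by
    have := (hvc.fderiv (𝕜 := ℝ)).norm
    exact this.comp_left (g := fun t : ℝ => t ^ 2) (by simp)
  have hdc : Continuous fun x => ‖fderiv ℝ v x‖ ^ 2 :=
    ((hv.continuous_fderiv one_ne_zero).norm).pow 2
  have hv2 : HasCompactSupport fun x => v x ^ 2 - 2 * c * v x :=
    hvc.comp_left (g := fun t : ℝ => t ^ 2 - 2 * c * t) (by simp)
  have hf2 : ∀ x, f x ^ 2 = (v x ^ 2 - 2 * c * v x) + c ^ 2 := fun x => by simp only [hf]; ring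
  have hvcont := hv.continuous
  have hv2c : Continuous fun x => v x ^ 2 - 2 * c * v x := by fun_prop
  obtain ⟨M₁, hM₁⟩ := hvcont.bounded_above_of_compact_support hvc
  obtain ⟨M₂, hM₂⟩ := hv2c.bounded_above_of_compact_support hv2
  obtain ⟨M₃, hM₃⟩ := hdc.bounded_above_of_compact_support hvd
  have hvu := hvc.uniformContinuous_of_continuous hvcont
  have hv2u := hv2.uniformContinuous_of_continuous hv2c
  have hvdu := hvd.uniformContinuous_of_continuous hdc
  have hΩfin : volume Ω < ⊤ := hΩb.measure_lt_top
  have hWint : ∀ {K}, K ⊆ Ω → IntegrableOn W K := fun hK =>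
    IntegrableOn.mono_set (t := Ω) (by
      have : IsFiniteMeasure (volume.restrict Ω) := ⟨by simpa using hΩfin⟩
      exact Integrable.of_bound hWm.aestronglyMeasurable M
        (Eventually.of_forall fun x => by rw [norm_of_nonneg (hW0 x)]; exact hWM x)) hK
  have hfM : ∀ x, |f x| ≤ M₁ + |c| := fun x =>
    (abs_sub _ _).trans (add_le_add (hM₁ x) le_rfl)
  have hf2M : ∀ x, |f x ^ 2| ≤ M₂ + |c ^ 2| := fun x => by
    rw [hf2]
    exact (abs_add_le _ _).trans (add_le_add (hM₂ x) le_rfl)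
  have i1 : ∀ {K}, K ⊆ Ω → IntegrableOn (fun x => f x * W x) K := fun hK =>
    (hWint hK).bdd_mul (c := M₁ + |c|) hfC.continuous.aestronglyMeasurable
      (Eventually.of_forall hfM)
  have i2 : ∀ {K}, K ⊆ Ω → IntegrableOn (fun x => f x ^ 2 * W x) K := fun hK =>
    (hWint hK).bdd_mul (c := M₂ + |c ^ 2|) (hfC.continuous.pow 2).aestronglyMeasurable
      (Eventually.of_forall hf2M)
  have i3 : ∀ {K}, K ⊆ Ω → IntegrableOn (fun x => ‖fderiv ℝ v x‖ ^ 2 * W x) K := fun hK =>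
    (hWint hK).bdd_mul (c := M₃) hdc.aestronglyMeasurable (Eventually.of_forall hM₃)
  by_contra! hcon
  set I := (k ^ 2 * ∫ x in Ω, f x ^ 2 * W x) - ∫ x in Ω, ‖fderiv ℝ v x‖ ^ 2 * W x with hI
  have hIpos : 0 < I := sub_pos.2 hcon
  set NΩ := ∫ x in Ω, W x with hNΩ
  have hNΩ0 : 0 ≤ NΩ := integral_nonneg hW0
  set δ := I / (NΩ + 1) with hδ
  have hδpos : 0 < δ := by positivity
  have hδN : δ * NΩ < I := by
    rw [hδ, div_mul_eq_mul_div, div_lt_iff₀ (by positivity)]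
    nlinarith
  set F₂ := fun x => (‖fderiv ℝ v x‖ ^ 2 - k ^ 2 * f x ^ 2 + δ) * W x with hF₂
  have hF₂i : ∀ {K}, K ⊆ Ω → IntegrableOn F₂ K ∧ ∫ x in K, F₂ x =
      (∫ x in K, ‖fderiv ℝ v x‖ ^ 2 * W x) - (k ^ 2 * ∫ x in K, f x ^ 2 * W x)
        + δ * ∫ x in K, W x := by
    intro K hK
    have e1 : F₂ = fun x => ‖fderiv ℝ v x‖ ^ 2 * W x - k ^ 2 * (f x ^ 2 * W x) + δ * W x := by
      funext x
      simp only [hF₂]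
      ring
    have j2 := (i2 hK).const_mul (k ^ 2)
    have j3 := (hWint hK).const_mul δ
    have j23 : Integrable (fun x => ‖fderiv ℝ v x‖ ^ 2 * W x - k ^ 2 * (f x ^ 2 * W x))
      (volume.restrict K) := (i3 hK).sub j2
    rw [e1]
    refine ⟨j23.add j3, ?_⟩
    rw [integral_add j23 j3, integral_sub (i3 hK) j2, integral_const_mul,
      integral_const_mul]
  set η := min 1 (δ / (1 + 2 * k ^ 2)) with hη
  have hηpos : 0 < η := lt_min one_pos (by positivity)
  have hηδ : η + k ^ 2 * η + k ^ 2 * η ^ 2 ≤ δ := by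
    have h1 : η ≤ 1 := min_le_left _ _
    have h2 : η * (1 + 2 * k ^ 2) ≤ δ := (le_div_iff₀ (by positivity)).1 (min_le_right _ _)
    have : k ^ 2 * η * η ≤ k ^ 2 * η * 1 := mul_le_mul_of_nonneg_left h1 (by positivity)
    nlinarith
  obtain ⟨r₁, hr₁, hr₁'⟩ := Metric.uniformContinuous_iff.1 hvu η hηpos
  obtain ⟨r₂, hr₂, hr₂'⟩ := Metric.uniformContinuous_iff.1 hv2u η hηpos
  obtain ⟨r₃, hr₃, hr₃'⟩ := Metric.uniformContinuous_iff.1 hvdu η hηpos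
  simp only [dist_eq_norm, norm_eq_abs] at hr₁' hr₂' hr₃'
  set d := Metric.diam Ω with hd
  obtain ⟨ε, hε, hε1, hε2, hε3, hε4⟩ : ∃ ε > 0, 2 * ε < r₁ ∧ 2 * ε < r₂ ∧ 2 * ε < r₃ ∧
      k * (d + 2 * ε) < π := by
    set t := (π - k * d) / k with ht
    have htpos : 0 < t := div_pos (by linarith) hk
    refine ⟨min (min r₁ r₂) (min r₃ t) / 4, by positivity, ?_, ?_, ?_, ?_⟩
    · have : min (min r₁ r₂) (min r₃ t) ≤ r₁ := (min_le_left _ _).trans (min_le_left _ _)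
      linarith
    · have : min (min r₁ r₂) (min r₃ t) ≤ r₂ := (min_le_left _ _).trans (min_le_right _ _)
      linarith
    · have : min (min r₁ r₂) (min r₃ t) ≤ r₃ := (min_le_right _ _).trans (min_le_left _ _)
      linarith
    · have : min (min r₁ r₂) (min r₃ t) ≤ t := (min_le_right _ _).trans (min_le_right _ _)
      have h2 : k * t = π - k * d := by rw [ht]; field_simp
      have h3 : k * (2 * (min (min r₁ r₂) (min r₃ t) / 4)) ≤ k * (t / 2) :=
        mul_le_mul_of_nonneg_left (by linarith) hk.le
      nlinarith
  obtain ⟨K, hKΩ, hKo, hKc, hK1, hK2, p, e, he, hthin⟩ := exists_thin_convex hΩo hΩc hΩb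
    (i1 subset_rfl) (hF₂i subset_rfl).1 hc (by
      rw [(hF₂i subset_rfl).2]
      linarith) hε
  have hKb := hΩb.subset hKΩ
  have hKm := hKo.measurableSet
  have hKne : K.Nonempty := by
    by_contra h
    rw [Set.not_nonempty_iff_eq_empty.1 h] at hK2
    simp at hK2
  obtain ⟨b, hbC, hb0, hblc, hbs, hb1⟩ := exists_logConcave_bump hε
  have hbcs : HasCompactSupport b := HasCompactSupport.intro (isCompact_Icc (a := -ε) (b := ε))
    fun s hs => hbs s (by
      by_contra hcon
      exact hs (abs_le.1 (not_lt.1 hcon)))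
  obtain ⟨Mb, hMb⟩ := hbC.continuous.bounded_above_of_compact_support hbcs
  set μ := (volume.restrict K).withDensity fun x => ENNReal.ofReal (W x) with hμ
  have : IsFiniteMeasure μ := isFiniteMeasure_withDensity_ofReal (hWint hKΩ).2
  have hμi : ∀ Q : EuclideanSpace ℝ (Fin n) → ℝ, ∫ x, Q x ∂μ = ∫ x in K, Q x * W x := by
    intro Q
    rw [hμ, integral_withDensity_eq_integral_toReal_smul hWm.ennreal_ofReal
      (Eventually.of_forall fun x => ENNReal.ofReal_lt_top)]
    refine integral_congr_ae (Eventually.of_forall fun x => ?_)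
    simp only [ENNReal.toReal_ofReal (hW0 x), smul_eq_mul]
    ring
  have hμK : ∀ᵐ x ∂μ, x ∈ K :=
    (withDensity_absolutelyContinuous _ _).ae_le (ae_restrict_mem hKm)
  set A := sInf ((fun x => ⟪e, x - p⟫) '' K) with hA
  have hdist : ∀ x ∈ K, ∀ y ∈ K, ⟪e, x - p⟫ - d ≤ ⟪e, y - p⟫ := by
    intro x hx y hy
    have h1 : ⟪e, x - p⟫ - ⟪e, y - p⟫ = ⟪e, x - y⟫ := by
      rw [← inner_sub_right, sub_sub_sub_cancel_right]
    have h2 := real_inner_le_norm e (x - y)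
    have h3 := Metric.dist_le_diam_of_mem hΩb (hKΩ hx) (hKΩ hy)
    rw [dist_eq_norm] at h3
    rw [he, one_mul] at h2
    linarith
  have hAB : ∀ x ∈ K, ⟪e, x - p⟫ ∈ Set.Icc A (A + d) := by
    intro x hx
    constructor
    · refine csInf_le ⟨⟪e, x - p⟫ - d, ?_⟩ ⟨x, hx, rfl⟩
      rintro _ ⟨y, hy, rfl⟩
      exact hdist x hx y hy
    · rw [← sub_le_iff_le_add]
      refine le_csInf (hKne.image _) ?_
      rintro _ ⟨y, hy, rfl⟩
      exact hdist x hx y hy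
  have hfin := thin_poincare (μ := μ) he (hμK.mono hthin) (hμK.mono hAB) hk
    (by rw [add_sub_cancel_left]; exact hε4) hbC hb0 hbs hb1 (by
      have := LogConcave.smoothed_marginal hKm hKc hKb hWm hW0 hWM hWlc p e hbC.continuous hb0
        (fun s => (le_abs_self _).trans (hMb s)) hblc
      simp only [hμi]
      simpa only [mul_comm] using this) hfC
    (M := max (max (M₁ + |c|) (M₂ + |c ^ 2|)) M₃) (η := η)
    (fun x => (hfM x).trans ((le_max_left _ _).trans (le_max_left _ _)))
    (fun x => (hf2M x).trans ((le_max_right _ _).trans (le_max_left _ _)))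
    (fun x => by rw [hfd]; exact (hM₃ x).trans (le_max_right _ _))
    (fun x y hxy => by
      have := (hr₁' (hxy.trans_lt hε1)).le
      simpa [hf] using this)
    (fun x y hxy => by
      have := (hr₂' (hxy.trans_lt hε2)).le
      rw [hf2, hf2, add_sub_add_right_eq_sub]
      exact this)
    (fun x y hxy => by
      rw [hfd]
      exact (hr₃' (hxy.trans_lt hε3)).le)
    (by rw [hμi]; exact hK1)
  have hN : μ.real Set.univ = ∫ x in K, W x := by
    have := hμi fun _ => 1
    simpa using this
  rw [hμi, hμi, hfd, hN] at hfin
  rw [(hF₂i hKΩ).2] at hK2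
  have hNK : 0 ≤ ∫ x in K, W x := integral_nonneg hW0
  have := mul_le_mul_of_nonneg_right hηδ hNK
  linarith

/-- Sharp Poincaré inequality on a bounded convex set with a log-concave weight. -/
lemma weighted_poincare {n : ℕ} [Nontrivial (EuclideanSpace ℝ (Fin n))]
    {Ω : Set (EuclideanSpace ℝ (Fin n))} (hΩo : IsOpen Ω) (hΩb : Bornology.IsBounded Ω)
    (hΩc : Convex ℝ Ω) {W : EuclideanSpace ℝ (Fin n) → ℝ} (hWm : Measurable W)
    (hW0 : ∀ x, 0 ≤ W x) {M : ℝ} (hWM : ∀ x, W x ≤ M) (hWlc : LogConcave W)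
    {v : EuclideanSpace ℝ (Fin n) → ℝ} (hv : ContDiff ℝ 1 v) (hvc : HasCompactSupport v) {c : ℝ}
    (hc : ∫ x in Ω, (v x - c) * W x = 0) :
    (π / Metric.diam Ω) ^ 2 * ∫ x in Ω, (v x - c) ^ 2 * W x
      ≤ ∫ x in Ω, ‖fderiv ℝ v x‖ ^ 2 * W x := by
  rcases (Metric.diam_nonneg (s := Ω)).eq_or_lt with hd | hd
  · rw [← hd, div_zero, zero_pow two_ne_zero, zero_mul]
    exact integral_nonneg fun x => mul_nonneg (sq_nonneg _) (hW0 x)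
  have hlim : Tendsto (fun k : ℝ => k ^ 2 * ∫ x in Ω, (v x - c) ^ 2 * W x)
      (nhdsWithin (π / Metric.diam Ω) (Set.Iio (π / Metric.diam Ω)))
      (nhds ((π / Metric.diam Ω) ^ 2 * ∫ x in Ω, (v x - c) ^ 2 * W x)) :=
    (Continuous.tendsto (by fun_prop) _).mono_left nhdsWithin_le_nhds
  refine le_of_tendsto hlim ?_
  filter_upwards [Ioo_mem_nhdsLT (show (0 : ℝ) < π / Metric.diam Ω by positivity)] with k hk
  exact weighted_poincare_of_lt hΩo hΩb hΩc hWm hW0 hWM hWlc hv hvc hc hk.1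
    ((lt_div_iff₀ hd).1 hk.2)

section Mollification

variable {E F : Type*} [NormedAddCommGroup E] [InnerProductSpace ℝ E] [FiniteDimensional ℝ E]
  [MeasurableSpace E] [BorelSpace E] [NormedAddCommGroup F] [NormedSpace ℝ F]

lemma norm_normed_convolution_le (ψ : ContDiffBump (0 : E)) {g : E → F} {C : ℝ}
    (hC : ∀ x, ‖g x‖ ≤ C) (x : E) :
    ‖MeasureTheory.convolution (ψ.normed volume) g (ContinuousLinearMap.lsmul ℝ ℝ) volume x‖
      ≤ C := by
  rw [convolution_def]
  calc _ ≤ ∫ t, ψ.normed volume t * C := by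
        refine norm_integral_le_of_norm_le (ψ.integrable_normed.mul_const _)
          (Eventually.of_forall fun t => ?_)
        rw [ContinuousLinearMap.lsmul_apply, norm_smul, norm_of_nonneg (ψ.nonneg_normed t)]
        exact mul_le_mul_of_nonneg_left (hC _) (ψ.nonneg_normed t)
    _ = C := by rw [integral_mul_const, ψ.integral_normed, one_mul]

/-- A compactly supported `C¹` function is a bounded limit, together with its derivative, of smooth
functions supported in a common compact set. -/
lemma exists_smooth_approx {φ : E → ℝ} (hφ : ContDiff ℝ 1 φ) (hφc : HasCompactSupport φ)
    {U : Set E} (hU : IsOpen U) (hφU : tsupport φ ⊆ U) :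
    ∃ K ⊆ U, IsCompact K ∧ ∃ (C : ℝ) (Φ : ℕ → E → ℝ), (∀ j, ContDiff ℝ (⊤ : ℕ∞) (Φ j)) ∧
      (∀ j, tsupport (Φ j) ⊆ K) ∧ (∀ j x, |Φ j x| ≤ C) ∧ (∀ j x, ‖fderiv ℝ (Φ j) x‖ ≤ C) ∧
      (∀ x, Tendsto (fun j => Φ j x) atTop (nhds (φ x))) ∧
      ∀ x, Tendsto (fun j => fderiv ℝ (Φ j) x) atTop (nhds (fderiv ℝ φ x)) := by
  obtain ⟨r, hr, hrU⟩ := hφc.isCompact.exists_cthickening_subset_open hU hφU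
  have hpos : ∀ j : ℕ, 0 < r / (j + 1) := fun j => by positivity
  let ψ : ℕ → ContDiffBump (0 : E) := fun j =>
    ⟨r / (j + 1) / 2, r / (j + 1), half_pos (hpos j), half_lt_self (hpos j)⟩
  have hψ : Tendsto (fun j => (ψ j).rOut) atTop (nhds 0) := by
    have := (tendsto_one_div_add_atTop_nhds_zero_nat (𝕜 := ℝ)).const_mul r
    rw [mul_zero] at this
    refine this.congr fun j => ?_
    rw [mul_one_div]
  have hcont := hφ.continuous
  have hdcont := hφ.continuous_fderiv one_ne_zero
  obtain ⟨C₁, hC₁⟩ := hcont.bounded_above_of_compact_support hφc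
  obtain ⟨C₂, hC₂⟩ := hdcont.bounded_above_of_compact_support (hφc.fderiv (𝕜 := ℝ))
  set Φ : ℕ → E → ℝ := fun j => MeasureTheory.convolution ((ψ j).normed volume) φ
    (ContinuousLinearMap.lsmul ℝ ℝ) volume with hΦ
  have hfd : ∀ j x, fderiv ℝ (Φ j) x = MeasureTheory.convolution ((ψ j).normed volume)
      (fderiv ℝ φ) (ContinuousLinearMap.lsmul ℝ ℝ) volume x := by
    intro j x
    have h := (hφc.hasFDerivAt_convolution_right (ContinuousLinearMap.lsmul ℝ ℝ)
      ((ψ j).integrable_normed (μ := volume)).locallyIntegrable hφ x).fderiv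
    rw [hΦ, h, convolution_def, convolution_def]
    congr 1
  refine ⟨_, hrU, hφc.isCompact.cthickening, max C₁ C₂, Φ, fun j => ?_, fun j => ?_,
    fun j x => (norm_normed_convolution_le _ hC₁ x).trans (le_max_left _ _), fun j x => ?_,
    fun x => ContDiffBump.convolution_tendsto_right_of_continuous hψ hcont x, fun x => ?_⟩
  · exact (ψ j).hasCompactSupport_normed.contDiff_convolution_left _ (ψ j).contDiff_normed
      hcont.locallyIntegrable
  · refine closure_minimal ?_ Metric.isClosed_cthickening
    refine (support_convolution_subset _).trans ?_
    rw [(ψ j).support_normed_eq]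
    rintro _ ⟨y, hy, z, hz, rfl⟩
    refine Metric.mem_cthickening_of_dist_le _ z _ _ (subset_tsupport φ hz) ?_
    simp only [dist_add_self_left]
    have h1 : ‖y‖ < r / (j + 1) := mem_ball_zero_iff.1 hy
    exact h1.le.trans (div_le_self hr.le (by simp))
  · rw [hfd]
    exact (norm_normed_convolution_le _ hC₂ x).trans (le_max_right _ _)
  · simp only [hfd]
    exact ContDiffBump.convolution_tendsto_right_of_continuous hψ hdcont x

end Mollification

lemma contDiff_div_of_tsupport_subset {E : Type*} [NormedAddCommGroup E] [NormedSpace ℝ E]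
    {Ω : Set E} (hΩ : IsOpen Ω) {w u : E → ℝ}
    (hw : ContDiffOn ℝ 1 w Ω) (hpos : ∀ x ∈ Ω, 0 < w x) (hu : ContDiff ℝ 1 u)
    (huΩ : tsupport u ⊆ Ω) : ContDiff ℝ 1 fun x => u x / w x := by
  rw [contDiff_iff_contDiffAt]
  intro x
  by_cases hx : x ∈ tsupport u
  · exact hu.contDiffAt.div (hw.contDiffAt (hΩ.mem_nhds (huΩ hx))) (hpos x (huΩ hx)).ne'
  · have : (fun x => u x / w x) =ᶠ[nhds x] fun _ => 0 := by
      filter_upwards [notMem_tsupport_iff_eventuallyEq.1 hx] with y hy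
      simp only [hy, Pi.zero_apply, zero_div]
    exact contDiffAt_const.congr_of_eventuallyEq this

/-- Pointwise Picone identity for `u = (u / w) w`. -/
lemma inner_gradient_ground_state {E : Type*} [NormedAddCommGroup E] [InnerProductSpace ℝ E]
    [CompleteSpace E] {Ω : Set E} (hΩ : IsOpen Ω) {w : E → ℝ}
    (hw : ContDiffOn ℝ 1 w Ω) (hpos : ∀ x ∈ Ω, 0 < w x) {u : E → ℝ} (hu : ContDiff ℝ 1 u)
    (huΩ : tsupport u ⊆ Ω) : ∀ x ∈ Ω, ⟪gradient w x, gradient (fun x => u x * (u x / w x)) x⟫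
      = ‖gradient u x‖ ^ 2 - ‖fderiv ℝ (fun x => u x / w x) x‖ ^ 2 * w x ^ 2 := by
  have hvC : ContDiff ℝ 1 fun x => u x / w x := contDiff_div_of_tsupport_subset hΩ hw hpos hu huΩ
  intro x hx
  obtain ⟨v, hv⟩ : ∃ v : E → ℝ, v = fun x => u x / w x := ⟨_, rfl⟩
  have hfun : (fun x => u x * (u x / w x)) = fun x => u x * v x := by rw [hv]
  rw [hfun, ← hv]
  rw [← hv] at hvC
  have dv : HasFDerivAt v (fderiv ℝ v x) x :=
    (hvC.differentiable one_ne_zero x).hasFDerivAt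
  have dw : HasFDerivAt w (fderiv ℝ w x) x :=
    ((hw.contDiffAt (hΩ.mem_nhds hx)).differentiableAt one_ne_zero).hasFDerivAt
  have hu_eq : u =ᶠ[nhds x] fun y => v y * w y := by
    filter_upwards [hΩ.mem_nhds hx] with y hy
    simp only [hv]
    rw [div_mul_cancel₀ _ (hpos y hy).ne']
  have du : fderiv ℝ u x = v x • fderiv ℝ w x + w x • fderiv ℝ v x := by
    rw [hu_eq.fderiv_eq]
    exact (dv.mul dw).fderiv
  have du' : HasFDerivAt u (v x • fderiv ℝ w x + w x • fderiv ℝ v x) x := by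
    rw [← du]
    exact (hu.differentiable one_ne_zero x).hasFDerivAt
  have dφ := (du'.mul dv).fderiv
  have hux : u x = v x * w x := hu_eq.eq_of_nhds
  have gw : gradient w x = (InnerProductSpace.toDual ℝ E).symm (fderiv ℝ w x) := rfl
  have hnv : ‖fderiv ℝ v x‖ = ‖gradient v x‖ :=
    ((InnerProductSpace.toDual ℝ E).symm.norm_map _).symm
  have gu : gradient u x = v x • gradient w x + w x • gradient v x := by
    simp only [gradient, du, map_add, map_smulₛₗ, conj_trivial]
  have gφ : gradient (fun x => u x * v x) x
      = (v x * w x) • gradient v x + v x • (v x • gradient w x + w x • gradient v x) := by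
    have e1 : fderiv ℝ (fun x => u x * v x) x = _ := dφ
    simp only [gradient, e1, map_add, map_smulₛₗ, conj_trivial, hux]
  rw [gu, gφ, hnv, ← real_inner_self_eq_norm_sq, ← real_inner_self_eq_norm_sq]
  simp only [inner_add_left, inner_add_right, inner_smul_left, inner_smul_right, conj_trivial,
    real_inner_comm (gradient w x) (gradient v x)]
  ring

section WeakEquation

variable {E : Type*} [NormedAddCommGroup E] [InnerProductSpace ℝ E] [FiniteDimensional ℝ E]
  [MeasurableSpace E] [BorelSpace E]

/-- A weak equation tested against smooth functions may be tested against `C¹` functions. -/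
lemma integral_inner_gradient_of_contDiff_one {Ω : Set E} (hΩ : IsOpen Ω) {w : E → ℝ}
    (hw : ContDiffOn ℝ 1 w Ω) {l : ℝ}
    (heq : ∀ φ : E → ℝ, ContDiff ℝ (⊤ : ℕ∞) φ → HasCompactSupport φ → tsupport φ ⊆ Ω →
      ∫ x in Ω, ⟪gradient w x, gradient φ x⟫ = l * ∫ x in Ω, w x * φ x)
    {φ : E → ℝ} (hφ : ContDiff ℝ 1 φ) (hφc : HasCompactSupport φ) (hφΩ : tsupport φ ⊆ Ω) :
    ∫ x in Ω, ⟪gradient w x, gradient φ x⟫ = l * ∫ x in Ω, w x * φ x := by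
  obtain ⟨K, hKΩ, hK, C, Φ, hΦ, hΦK, hΦC, hΦC', hΦl, hΦl'⟩ :=
    exists_smooth_approx hφ hφc hΩ hφΩ
  have hΦc : ∀ j, HasCompactSupport (Φ j) := fun j =>
    hK.of_isClosed_subset (isClosed_tsupport _) (hΦK j)
  have hgc : ContinuousOn (gradient w) Ω :=
    (InnerProductSpace.toDual ℝ E).symm.continuous.comp_continuousOn
      (hw.continuousOn_fderiv_of_isOpen hΩ le_rfl)
  obtain ⟨D, hD⟩ := hK.exists_bound_of_continuousOn (hgc.mono hKΩ)
  obtain ⟨D', hD'⟩ := hK.exists_bound_of_continuousOn (hw.continuousOn.mono hKΩ)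
  have hin : ∀ (f : E → ℝ) x, ⟪gradient w x, gradient f x⟫ = fderiv ℝ f x (gradient w x) := by
    intro f x
    rw [real_inner_comm]
    exact InnerProductSpace.toDual_symm_apply
  have hbd : ∀ B : ℝ, Integrable (K.indicator fun _ => B) (volume.restrict Ω) := fun B =>
    ((integrable_indicator_iff hK.measurableSet).2
      (integrableOn_const hK.measure_lt_top.ne)).integrableOn
  have l1 : Tendsto (fun j => ∫ x in Ω, ⟪gradient w x, gradient (Φ j) x⟫) atTop
      (nhds (∫ x in Ω, ⟪gradient w x, gradient φ x⟫)) := by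
    simp only [hin]
    refine tendsto_integral_of_dominated_convergence (K.indicator fun _ => C * D) (fun j => ?_)
      (hbd _) (fun j => Eventually.of_forall fun x => ?_) (Eventually.of_forall fun x => ?_)
    · refine ContinuousOn.aestronglyMeasurable ?_ hΩ.measurableSet
      exact ((hΦ j).continuous_fderiv (by simp)).continuousOn.clm_apply hgc
    · by_cases hx : x ∈ K
      · rw [Set.indicator_of_mem hx]
        refine ((fderiv ℝ (Φ j) x).le_opNorm _).trans ?_
        exact mul_le_mul (hΦC' j x) (hD x hx) (norm_nonneg _) ((norm_nonneg _).trans (hΦC' j x))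
      · rw [Set.indicator_of_notMem hx, fderiv_of_notMem_tsupport ℝ fun h => hx (hΦK j h)]
        simp
    · exact ((ContinuousLinearMap.apply ℝ ℝ (gradient w x)).continuous.tendsto _).comp (hΦl' x)
  have l2 : Tendsto (fun j => l * ∫ x in Ω, w x * Φ j x) atTop
      (nhds (l * ∫ x in Ω, w x * φ x)) := by
    refine Tendsto.const_mul l ?_
    refine tendsto_integral_of_dominated_convergence (K.indicator fun _ => D' * C) (fun j => ?_)
      (hbd _) (fun j => Eventually.of_forall fun x => ?_) (Eventually.of_forall fun x => ?_)
    · exact (hw.continuousOn.mul (hΦ j).continuous.continuousOn).aestronglyMeasurable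
        hΩ.measurableSet
    · by_cases hx : x ∈ K
      · rw [Set.indicator_of_mem hx, norm_mul]
        exact mul_le_mul (hD' x hx) (hΦC j x) (norm_nonneg _) ((norm_nonneg _).trans (hD' x hx))
      · rw [Set.indicator_of_notMem hx, image_eq_zero_of_notMem_tsupport fun h => hx (hΦK j h)]
        simp
    · exact (hΦl x).const_mul (w x)
  refine tendsto_nhds_unique l1 (l2.congr fun j => ?_)
  exact (heq (Φ j) (hΦ j) (hΦc j) ((hΦK j).trans hKΩ)).symm

/-- Ground-state representation of the quadratic form of `-Δ - l`. -/
lemma ground_state_identity {Ω : Set E} (hΩ : IsOpen Ω) {w : E → ℝ}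
    (hw : ContDiffOn ℝ 1 w Ω) (hpos : ∀ x ∈ Ω, 0 < w x) {l : ℝ}
    (heq : ∀ φ : E → ℝ, ContDiff ℝ (⊤ : ℕ∞) φ → HasCompactSupport φ → tsupport φ ⊆ Ω →
      ∫ x in Ω, ⟪gradient w x, gradient φ x⟫ = l * ∫ x in Ω, w x * φ x)
    {u : E → ℝ} (hu : ContDiff ℝ 1 u) (huc : HasCompactSupport u) (huΩ : tsupport u ⊆ Ω) :
    (∫ x in Ω, ‖gradient u x‖ ^ 2) - l * ∫ x in Ω, |u x| ^ 2
      = ∫ x in Ω, ‖fderiv ℝ (fun x => u x / w x) x‖ ^ 2 * w x ^ 2 := by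
  set v : E → ℝ := fun x => u x / w x with hv
  have hvC : ContDiff ℝ 1 v := contDiff_div_of_tsupport_subset hΩ hw hpos hu huΩ
  have hvt : tsupport v ⊆ tsupport u := by
    refine closure_mono fun x hx => ?_
    intro h
    exact hx (by simp only [hv, h, zero_div])
  have hφt : tsupport (fun x => u x * v x) ⊆ tsupport u := tsupport_mul_subset_left
  have key := integral_inner_gradient_of_contDiff_one hΩ hw heq (hu.mul hvC) huc.mul_right
    (hφt.trans huΩ)
  have hmass : ∫ x in Ω, w x * (u x * v x) = ∫ x in Ω, |u x| ^ 2 := by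
    refine setIntegral_congr_fun hΩ.measurableSet fun x hx => ?_
    have := (hpos x hx).ne'
    simp only [hv, sq_abs]
    field_simp
  have hpt := inner_gradient_ground_state hΩ hw hpos hu huΩ
  have hgu : Integrable (fun x => ‖gradient u x‖ ^ 2) (volume.restrict Ω) := by
    have h1 : (fun x => ‖gradient u x‖ ^ 2) = fun x => ‖fderiv ℝ u x‖ ^ 2 := by
      funext x
      rw [show ‖gradient u x‖ = ‖fderiv ℝ u x‖ from
        (InnerProductSpace.toDual ℝ E).symm.norm_map _]
    have h2 : Continuous fun x => ‖fderiv ℝ u x‖ ^ 2 :=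
      ((hu.continuous_fderiv one_ne_zero).norm).pow 2
    have h3 : HasCompactSupport fun x => ‖fderiv ℝ u x‖ ^ 2 := by
      have := (huc.fderiv (𝕜 := ℝ)).norm
      exact this.comp_left (g := fun t : ℝ => t ^ 2) (by simp)
    rw [h1]
    exact (h2.integrable_of_hasCompactSupport h3).integrableOn
  have hgv : Integrable (fun x => ‖fderiv ℝ v x‖ ^ 2 * w x ^ 2) (volume.restrict Ω) := by
    have h1 : IntegrableOn (fun x => ‖fderiv ℝ v x‖ ^ 2 * w x ^ 2) (tsupport u) := by
      refine ContinuousOn.integrableOn_compact huc.isCompact ?_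
      exact (((hvC.continuous_fderiv one_ne_zero).norm).pow 2).continuousOn.mul
        ((hw.continuousOn.mono huΩ).pow 2)
    refine h1.of_forall_sdiff_eq_zero hΩ.measurableSet fun x hx => ?_
    rw [fderiv_of_notMem_tsupport ℝ fun h => hx.2 (hvt h)]
    simp
  rw [← hmass, ← key, setIntegral_congr_fun hΩ.measurableSet hpt, integral_sub hgu hgv]
  ring

end WeakEquation

/-- The square of a positive log-concave function on a convex set, extended by zero, is
log-concave. -/
lemma logConcave_indicator_sq {E : Type*} [NormedAddCommGroup E] [NormedSpace ℝ E]
    {Ω : Set E} {w : E → ℝ} (hpos : ∀ x ∈ Ω, 0 < w x)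
    (hlc : ConcaveOn ℝ Ω fun x => Real.log (w x)) :
    LogConcave (Ω.indicator fun x => w x ^ 2) := by
  intro x y a b ha hb hab
  have hnn : 0 ≤ Ω.indicator (fun x => w x ^ 2) (a • x + b • y) :=
    Set.indicator_nonneg (fun _ _ => sq_nonneg _) _
  by_cases hx : x ∈ Ω
  · by_cases hy : y ∈ Ω
    · have hz := hlc.1 hx hy ha.le hb.le hab
      have h := hlc.2 hx hy ha.le hb.le hab
      simp only [smul_eq_mul] at h
      rw [Set.indicator_of_mem hx, Set.indicator_of_mem hy, Set.indicator_of_mem hz]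
      have px := pow_pos (hpos x hx) 2
      have py := pow_pos (hpos y hy) 2
      have pz := pow_pos (hpos _ hz) 2
      rw [Real.rpow_def_of_pos px, Real.rpow_def_of_pos py, ← Real.exp_add,
        ← Real.le_log_iff_exp_le pz, Real.log_pow, Real.log_pow, Real.log_pow]
      push_cast
      linarith
    · rw [Set.indicator_of_notMem hy, Real.zero_rpow hb.ne', mul_zero]
      exact hnn
  · rw [Set.indicator_of_notMem hx, Real.zero_rpow ha.ne', zero_mul]
    exact hnn

/-- Stability of the `L²`-Poincaré inequality on a bounded convex domain, with the explicit
constant `(π / diam Ω)²`.  The first Dirichlet eigenfunction `u₁` of the Laplacian is positive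
in `Ω`, `C¹` in `Ω`, continuous up to and vanishing on the boundary, a weak solution of
`-Δu₁ = λ₁ u₁`, and `log u₁` is concave (Brascamp–Lieb/Sakaguchi). -/
theorem stability_L2_poincare
    {n : ℕ} (hn : 2 ≤ n)
    {Ω : Set (EuclideanSpace ℝ (Fin n))}
    (hΩo : IsOpen Ω) (hΩb : Bornology.IsBounded Ω) (hΩc : Convex ℝ Ω)
    (u₁ : EuclideanSpace ℝ (Fin n) → ℝ)
    (hu₁C : ContDiffOn ℝ 1 u₁ Ω)
    (hu₁pos : ∀ x ∈ Ω, 0 < u₁ x)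
    (hu₁cont : ContinuousOn u₁ (closure Ω))
    (hu₁bd : ∀ x ∈ frontier Ω, u₁ x = 0)
    (hu₁eig : ∀ φ : EuclideanSpace ℝ (Fin n) → ℝ,
      ContDiff ℝ (⊤ : ℕ∞) φ → HasCompactSupport φ → tsupport φ ⊆ Ω →
      ∫ x in Ω, ⟪gradient u₁ x, gradient φ x⟫
        = lambda1 n 2 Ω * ∫ x in Ω, u₁ x * φ x)
    (hu₁lc : ConcaveOn ℝ Ω fun x => Real.log (u₁ x))
    (u : EuclideanSpace ℝ (Fin n) → ℝ)
    (huC : ContDiff ℝ (⊤ : ℕ∞) u) (huK : HasCompactSupport u) (huS : tsupport u ⊆ Ω) :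
    (∫ x in Ω, ‖gradient u x‖ ^ 2) - lambda1 n 2 Ω * ∫ x in Ω, |u x| ^ 2
      ≥ (Real.pi / Metric.diam Ω) ^ 2 *
        ⨅ c : ℝ, ∫ x in Ω, |u x - c * u₁ x| ^ 2 := by
  have : Nonempty (Fin n) := ⟨⟨0, by omega⟩⟩
  have : Nontrivial (EuclideanSpace ℝ (Fin n)) := inferInstance
  have hmΩ := hΩo.measurableSet
  set W : EuclideanSpace ℝ (Fin n) → ℝ := Ω.indicator fun x => u₁ x ^ 2 with hW
  set v : EuclideanSpace ℝ (Fin n) → ℝ := fun x => u x / u₁ x with hv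
  have hW0 : ∀ x, 0 ≤ W x := Set.indicator_nonneg fun _ _ => sq_nonneg _
  have hWΩ : ∀ x ∈ Ω, W x = u₁ x ^ 2 := fun x hx => Set.indicator_of_mem hx _
  have hWm : Measurable W := by
    classical
    have h := (hu₁C.continuousOn.pow 2).measurable_piecewise
      (continuousOn_const (c := (0 : ℝ)) (s := Ωᶜ)) hmΩ
    convert h using 1
    funext x
    by_cases hx : x ∈ Ω
    · simp [hW, hx]
    · simp [hW, hx]
  obtain ⟨M, hM⟩ := hΩb.isCompact_closure.exists_bound_of_continuousOn (hu₁cont.pow 2)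
  have hWM : ∀ x, W x ≤ max M 0 := by
    intro x
    by_cases hx : x ∈ Ω
    · rw [hWΩ x hx]
      exact ((le_abs_self _).trans (hM x (subset_closure hx))).trans (le_max_left _ _)
    · rw [hW, Set.indicator_of_notMem hx]
      exact le_max_right _ _
  have hWi : IntegrableOn W Ω := by
    refine Measure.integrableOn_of_bounded hΩb.measure_lt_top.ne hWm.aestronglyMeasurable
      (M := max M 0) (Eventually.of_forall fun x => ?_)
    rw [Real.norm_of_nonneg (hW0 x)]
    exact hWM x
  have hvC : ContDiff ℝ 1 v :=
    contDiff_div_of_tsupport_subset hΩo hu₁C hu₁pos (huC.of_le (by simp)) huS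
  have hvc : HasCompactSupport v := by
    refine huK.mono fun x hx h => hx ?_
    simp only [hv, h, zero_div]
  obtain ⟨B, hB⟩ := hvc.exists_bound_of_continuous hvC.continuous
  have hvWi : IntegrableOn (fun x => v x * W x) Ω :=
    hWi.bdd_mul hvC.continuous.aestronglyMeasurable (Eventually.of_forall hB)
  have hmean : ∃ c : ℝ, ∫ x in Ω, (v x - c) * W x = 0 := by
    by_cases h0 : ∫ x in Ω, W x = 0
    · refine ⟨0, integral_eq_zero_of_ae ?_⟩
      filter_upwards [(integral_eq_zero_iff_of_nonneg hW0 hWi).1 h0] with x hx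
      rw [hx, Pi.zero_apply, mul_zero]
    · refine ⟨(∫ x in Ω, v x * W x) / ∫ x in Ω, W x, ?_⟩
      simp only [sub_mul]
      rw [integral_sub hvWi (hWi.const_mul _), integral_const_mul, div_mul_cancel₀ _ h0, sub_self]
  obtain ⟨c, hc⟩ := hmean
  have hP := weighted_poincare hΩo hΩb hΩc hWm hW0 hWM
    (logConcave_indicator_sq hu₁pos hu₁lc) hvC hvc hc
  have hL : ∫ x in Ω, (v x - c) ^ 2 * W x = ∫ x in Ω, |u x - c * u₁ x| ^ 2 := by
    refine setIntegral_congr_fun hmΩ fun x hx => ?_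
    have := (hu₁pos x hx).ne'
    simp only [hWΩ x hx, hv, sq_abs]
    field_simp
  have hR : ∫ x in Ω, ‖fderiv ℝ v x‖ ^ 2 * W x = ∫ x in Ω, ‖fderiv ℝ v x‖ ^ 2 * u₁ x ^ 2 :=
    setIntegral_congr_fun hmΩ fun x hx => by simp only [hWΩ x hx]
  rw [ground_state_identity hΩo hu₁C hu₁pos hu₁eig (huC.of_le (by simp)) huK huS, ge_iff_le,
    ← hR]
  rw [hL] at hP
  refine le_trans (mul_le_mul_of_nonneg_left (ciInf_le ⟨0, ?_⟩ c) (sq_nonneg _)) hP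
  rintro _ ⟨d, rfl⟩
  exact integral_nonneg fun x => sq_nonneg _
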